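/- arXiv:1802.08574 — 5 statements merged into one kernel-verified Lean document; each statement's English description precedes it below -/
import Mathlib

section
/- If X ⊆ 2^ℕ is 𝔈-additive, then for every E ∈ 𝔈 and every Lipschitz mapping φ : 2^ℕ × 2^ℕ → 2^ℕ (with the maximum metric on the product and the least-difference metric on each factor), the image φ(X × E) belongs to 𝔈. -/
/-- The Cantor space `2^ℕ`. -/
abbrev Cantor : Type := ℕ → ZMod 2

/-- The least-difference metric `d(x,y) = 2^{-min{i : x i ≠ y i}}` on the Cantor space. -/
noncomputable instance : MetricSpace Cantor := PiNat.metricSpace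

noncomputable instance : MeasurableSpace Cantor := borel Cantor
instance : BorelSpace Cantor := ⟨rfl⟩

/-- Membership in the σ-ideal `𝔈`: `E` is contained in an `F_σ` set of Haar measure zero. -/
def MemE (E : Set Cantor) : Prop :=
  ∃ F : Set Cantor, E ⊆ F ∧ MeasureTheory.Measure.addHaar F = 0 ∧
    ∃ C : ℕ → Set Cantor, (∀ n, IsClosed (C n)) ∧ F = ⋃ n, C n

open Pointwise

namespace CantorAux

open MeasureTheory Filter Topology Set

/-- The first `n` coordinates. -/
def res (n : ℕ) (x : Cantor) : Fin n → ZMod 2 := fun i => x i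

/-- Extension of a finite word by zeros. -/
def ext (n : ℕ) (w : Fin n → ZMod 2) : Cantor := fun i => if h : i < n then w ⟨i, h⟩ else 0

/-- The cylinder determined by a finite word. -/
def fib (n : ℕ) (w : Fin n → ZMod 2) : Set Cantor := {z | res n z = w}

/-- The points that agree with some point of `F` on the first `n` coordinates. -/
def nbhd (F : Set Cantor) (n : ℕ) : Set Cantor := {z | ∃ w ∈ F, res n z = res n w}

/-- Haar measure on the Cantor space. -/
noncomputable abbrev haar : Measure Cantor := Measure.addHaar

lemma add_add_self (x y : ZMod 2) : x + (y + x) = y := by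
  revert x y; decide

lemma haar_univ_pos : 0 < haar.real univ := by
  rw [measureReal_def, ENNReal.toReal_pos_iff]
  exact ⟨isOpen_univ.measure_pos _ univ_nonempty, measure_lt_top _ _⟩

lemma ext_apply_of_lt {n i : ℕ} (w : Fin n → ZMod 2) (h : i < n) : ext n w i = w ⟨i, h⟩ :=
  dif_pos h

lemma ext_apply_of_le {n i : ℕ} (w : Fin n → ZMod 2) (h : n ≤ i) : ext n w i = 0 :=
  dif_neg h.not_gt

lemma res_ext (n : ℕ) (w : Fin n → ZMod 2) : res n (ext n w) = w :=
  funext fun i => ext_apply_of_lt w i.2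

lemma ext_res_apply {n i : ℕ} (x : Cantor) (h : i < n) : ext n (res n x) i = x i :=
  ext_apply_of_lt _ h

lemma res_eq_iff {n : ℕ} {x y : Cantor} : res n x = res n y ↔ ∀ i < n, x i = y i :=
  ⟨fun h i hi => congrFun h ⟨i, hi⟩, fun h => funext fun i => h i i.2⟩

lemma mem_fib {n : ℕ} {x : Cantor} {w : Fin n → ZMod 2} : x ∈ fib n w ↔ res n x = w := Iff.rfl

lemma continuous_res (n : ℕ) : Continuous (res n) :=
  continuous_pi fun i => continuous_apply (i : ℕ)

lemma isClopen_res_preimage (n : ℕ) (A : Set (Fin n → ZMod 2)) : IsClopen (res n ⁻¹' A) :=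
  (isClopen_discrete A).preimage (continuous_res n)

lemma isClopen_fib (n : ℕ) (w : Fin n → ZMod 2) : IsClopen (fib n w) :=
  isClopen_res_preimage n {w}

lemma measurableSet_fib (n : ℕ) (w : Fin n → ZMod 2) : MeasurableSet (fib n w) :=
  (isClopen_fib n w).isClosed.measurableSet

lemma pairwise_disjoint_fib (n : ℕ) : Pairwise (Function.onFun Disjoint (fib n)) := by
  intro v w hvw
  rw [Function.onFun, Set.disjoint_left]
  intro z hz hz'
  exact hvw (hz.symm.trans hz')

lemma nbhd_eq_preimage (F : Set Cantor) (n : ℕ) : nbhd F n = res n ⁻¹' (res n '' F) := by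
  ext z
  simp only [nbhd, mem_ofPred_eq, mem_preimage, mem_image, eq_comm]

lemma measurableSet_nbhd (F : Set Cantor) (n : ℕ) : MeasurableSet (nbhd F n) := by
  rw [nbhd_eq_preimage]
  exact (isClopen_res_preimage n _).isClosed.measurableSet

/-- Every neighbourhood of a point contains a cylinder around it. -/
lemma exists_fib_subset {U : Set Cantor} (hU : IsOpen U) {x : Cantor} (hx : x ∈ U) :
    ∃ n, fib n (res n x) ⊆ U := by
  obtain ⟨ε, hε, hb⟩ := Metric.isOpen_iff.1 hU x hx
  obtain ⟨n, hn⟩ := exists_pow_lt_of_lt_one hε (by norm_num : (1 / 2 : ℝ) < 1)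
  refine ⟨n, fun z hz => hb (lt_of_le_of_lt ?_ hn)⟩
  exact PiNat.mem_cylinder_iff_dist_le.1 (fun i hi => res_eq_iff.1 hz i hi)

lemma iInter_nbhd {F : Set Cantor} (hF : IsClosed F) : ⋂ n, nbhd F n = F := by
  refine Subset.antisymm (fun z hz => ?_) (subset_iInter fun n z hz => ⟨z, hz, rfl⟩)
  by_contra hzF
  obtain ⟨n, hn⟩ := exists_fib_subset hF.isOpen_compl hzF
  obtain ⟨w, hw, hzw⟩ := mem_iInter.1 hz n
  exact hn hzw.symm hw

lemma tendsto_haar_nbhd {F : Set Cantor} (hF : IsClosed F) (h0 : haar F = 0) :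
    Tendsto (fun n => haar.real (nbhd F n)) atTop (𝓝 0) := by
  have h := tendsto_measure_iInter_atTop (μ := haar) (s := nbhd F)
    (fun n => (measurableSet_nbhd F n).nullMeasurableSet)
    (fun m n hmn z ⟨w, hw, hz⟩ =>
      ⟨w, hw, res_eq_iff.2 fun i hi => res_eq_iff.1 hz i (hi.trans_le hmn)⟩)
    ⟨0, measure_ne_top _ _⟩
  rw [iInter_nbhd hF, h0] at h
  simpa [measureReal_def, Function.comp_def] using
    (ENNReal.tendsto_toReal ENNReal.zero_ne_top).comp h

lemma haar_eq_sum (n : ℕ) {B : Set Cantor} (hB : MeasurableSet B) :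
    haar.real B = ∑ w, haar.real (B ∩ fib n w) := by
  rw [← measureReal_biUnion_finset]
  · congr 1
    ext z
    simp [mem_fib]
  · intro v _ w _ hvw
    exact (pairwise_disjoint_fib n hvw).mono inter_subset_right inter_subset_right
  · exact fun w _ => hB.inter (measurableSet_fib n w)

lemma haar_preimage_add (g : Cantor) (A : Set Cantor) :
    haar.real ((fun z => g + z) ⁻¹' A) = haar.real A := by
  rw [measureReal_def, measure_preimage_add, measureReal_def]

/-- A set that does not depend on the first `n` coordinates has the same measure in each cylinder
of length `n`. -/
lemma haar_inter_fib (n : ℕ) {B : Set Cantor} (hB : MeasurableSet B)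
    (hinv : ∀ z z' : Cantor, (∀ i, n ≤ i → z i = z' i) → z ∈ B → z' ∈ B) (w : Fin n → ZMod 2) :
    haar.real (B ∩ fib n w) * 2 ^ n = haar.real B := by
  have key : ∀ v, haar.real (B ∩ fib n v) = haar.real (B ∩ fib n w) := by
    intro v
    rw [← haar_preimage_add (ext n (v + w)) (B ∩ fib n v)]
    congr 1
    ext z
    have h1 : ∀ i, n ≤ i → (ext n (v + w) + z) i = z i := fun i hi => by
      simp [ext_apply_of_le _ hi]
    have h2 : res n (ext n (v + w) + z) = v + w + res n z := by
      rw [← res_ext n (v + w)]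
      funext i
      simp [res, ext]
    simp only [mem_preimage, mem_inter_iff, mem_fib, h2]
    refine and_congr ⟨hinv _ _ h1, hinv _ _ fun i hi => (h1 i hi).symm⟩ ?_
    constructor
    · intro h
      funext i
      have := congrFun h i
      simp only [Pi.add_apply] at this
      generalize v i = a, w i = b, res n z i = c at *
      revert a b c; decide
    · rintro rfl
      funext i
      simp only [Pi.add_apply]
      generalize v i = a, res n z i = c at *
      revert a c; decide
  rw [haar_eq_sum n hB, Finset.sum_congr rfl fun v _ => key v]
  simp [mul_comm]

lemma haar_fib (n : ℕ) (w : Fin n → ZMod 2) :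
    haar.real (fib n w) * 2 ^ n = haar.real univ := by
  simpa using haar_inter_fib n MeasurableSet.univ (fun _ _ _ _ => mem_univ _) w

lemma haar_nbhd (F : Set Cantor) (n : ℕ) :
    haar.real (nbhd F n) * 2 ^ n = (res n '' F).ncard * haar.real univ := by
  classical
  have h : nbhd F n = ⋃ w ∈ (res n '' F).toFinset, fib n w := by
    ext z
    simp [nbhd, mem_fib, eq_comm]
  rw [h, measureReal_biUnion_finset (fun v _ w _ hvw => pairwise_disjoint_fib n hvw)
    (fun w _ => measurableSet_fib n w), Finset.sum_mul, Finset.sum_congr rfl fun w _ => haar_fib n w,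
    Finset.sum_const, nsmul_eq_mul, Set.ncard_eq_toFinset_card']

lemma memE_of_isClosed {F : Set Cantor} (hF : IsClosed F) (h0 : haar F = 0) : MemE F :=
  ⟨F, Subset.rfl, h0, fun _ => F, fun _ => hF, (iUnion_const F).symm⟩

lemma memE_iUnion {ι : Type*} [Countable ι] {A : ι → Set Cantor} (hA : ∀ i, MemE (A i)) :
    MemE (⋃ i, A i) := by
  choose F hAF hF0 C hC hFC using hA
  rcases isEmpty_or_nonempty ι with hι | hι
  · rw [iUnion_of_empty]
    exact memE_of_isClosed isClosed_empty measure_empty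
  obtain ⟨e, he⟩ := exists_surjective_nat (ι × ℕ)
  refine ⟨⋃ i, F i, iUnion_mono hAF, measure_iUnion_null hF0,
    fun n => C (e n).1 (e n).2, fun n => hC _ _, ?_⟩
  rw [he.iUnion_comp fun p : ι × ℕ => C p.1 p.2, iUnion_prod']
  exact iUnion_congr hFC

lemma memE_mono {A B : Set Cantor} (hB : MemE B) (h : A ⊆ B) : MemE A :=
  let ⟨F, hF, r⟩ := hB
  ⟨F, h.trans hF, r⟩

/-- A nondegenerate quadratic form in the coordinates `a, …, a + 2 * m - 1`. -/
def quad (a m : ℕ) (z : Cantor) : ZMod 2 := ∑ l ∈ Finset.range m, z (a + l) * z (a + m + l)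

lemma quad_congr {a m : ℕ} {z z' : Cantor} (h : ∀ i, a ≤ i → i < a + 2 * m → z i = z' i) :
    quad a m z = quad a m z' := by
  refine Finset.sum_congr rfl fun l hl => ?_
  rw [Finset.mem_range] at hl
  rw [h _ (by omega) (by omega), h _ (by omega) (by omega)]

lemma continuous_quad (a m : ℕ) : Continuous (quad a m) := by
  have : ContinuousMul (ZMod 2) := ⟨continuous_of_discreteTopology⟩
  unfold quad
  fun_prop

lemma quad_zero (a m : ℕ) : quad a m 0 = 0 := by
  simp [quad]

lemma quad_single_add_left {a m l : ℕ} (hl : l < m) (z : Cantor) :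
    quad a m (Pi.single (a + l) 1 + z) = quad a m z + z (a + m + l) := by
  have h : ∀ k ∈ Finset.range m,
      (Pi.single (a + l) 1 + z : Cantor) (a + k) * (Pi.single (a + l) 1 + z : Cantor) (a + m + k)
        = z (a + k) * z (a + m + k) + if k = l then z (a + m + l) else 0 := by
    intro k hk
    rw [Finset.mem_range] at hk
    have h1 : a + m + k ≠ a + l := by omega
    rcases eq_or_ne k l with rfl | hkl
    · simp [Pi.single_eq_of_ne h1]; ring
    · simp [Pi.single_eq_of_ne h1, hkl]
  rw [quad, Finset.sum_congr rfl h, Finset.sum_add_distrib, Finset.sum_ite_eq' ,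
    if_pos (Finset.mem_range.2 hl), quad]

lemma quad_single_add_right {a m l : ℕ} (hl : l < m) (z : Cantor) :
    quad a m (Pi.single (a + m + l) 1 + z) = quad a m z + z (a + l) := by
  have h : ∀ k ∈ Finset.range m,
      (Pi.single (a + m + l) 1 + z : Cantor) (a + k) *
          (Pi.single (a + m + l) 1 + z : Cantor) (a + m + k)
        = z (a + k) * z (a + m + k) + if k = l then z (a + l) else 0 := by
    intro k hk
    rw [Finset.mem_range] at hk
    have h1 : a + k ≠ a + m + l := by omega
    rcases eq_or_ne k l with rfl | hkl
    · simp [Pi.single_eq_of_ne h1]; ring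
    · simp [Pi.single_eq_of_ne h1, hkl]
  rw [quad, Finset.sum_congr rfl h, Finset.sum_add_distrib, Finset.sum_ite_eq' ,
    if_pos (Finset.mem_range.2 hl), quad]

/-- The nontrivial character of `ZMod 2`. -/
def sgn (v : ZMod 2) : ℤ := if v = 0 then 1 else -1

lemma sgn_add_mul_sgn_add (u v x y z : ZMod 2) (h : y ≠ z) :
    sgn (u + (x + y)) * sgn (v + (x + z)) = -(sgn u * sgn v) := by
  revert u v x y z; decide

lemma ext_single_add {n p : ℕ} (hp : p < n) (h : Fin n → ZMod 2) :
    ext n (Pi.single ⟨p, hp⟩ 1 + h) = Pi.single p 1 + ext n h := by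
  funext i
  by_cases hi : i < n
  · simp [ext, hi, Pi.single_apply, Fin.ext_iff]
  · have : i ≠ p := by omega
    simp [ext, hi, Pi.single_eq_of_ne this]

/-- Distinct translates of `sgn ∘ quad` are orthogonal. -/
lemma sum_sgn_quad_eq_zero {a m n : ℕ} (hn : a + 2 * m ≤ n) {s t : Cantor} {i : ℕ} (hai : a ≤ i)
    (hi : i < a + 2 * m) (hst : s i ≠ t i) :
    ∑ h : Fin n → ZMod 2, sgn (quad a m (ext n h + s)) * sgn (quad a m (ext n h + t)) = 0 := by
  obtain ⟨p, hp, hq⟩ : ∃ p < n, ∀ z : Cantor, quad a m (Pi.single p 1 + z) = quad a m z + z i := by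
    rcases lt_or_ge i (a + m) with him | him
    · obtain ⟨l, rfl⟩ := Nat.exists_eq_add_of_le hai
      exact ⟨a + m + l, by omega, quad_single_add_right (by omega)⟩
    · obtain ⟨l, rfl⟩ := Nat.exists_eq_add_of_le him
      exact ⟨a + l, by omega, quad_single_add_left (by omega)⟩
  have key := Equiv.sum_comp (Equiv.addLeft (Pi.single ⟨p, hp⟩ 1 : Fin n → ZMod 2))
    fun h => sgn (quad a m (ext n h + s)) * sgn (quad a m (ext n h + t))
  have h2 : ∀ h : Fin n → ZMod 2,
      sgn (quad a m (ext n (Pi.single ⟨p, hp⟩ 1 + h) + s)) *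
        sgn (quad a m (ext n (Pi.single ⟨p, hp⟩ 1 + h) + t)) =
      -(sgn (quad a m (ext n h + s)) * sgn (quad a m (ext n h + t))) := by
    intro h
    rw [ext_single_add, add_assoc, add_assoc, hq, hq]
    exact sgn_add_mul_sgn_add _ _ _ _ _ hst
  simp only [Equiv.coe_addLeft, h2, Finset.sum_neg_distrib] at key
  omega

/-- Few points lie outside the union of many translates of the zero set of `quad`. -/
lemma card_bad_mul_le {a m n : ℕ} (hn : a + 2 * m ≤ n) (T : Finset (Fin n → ZMod 2))
    (hT : ∀ s ∈ T, ∀ t ∈ T, s ≠ t → ∃ i, a ≤ i ∧ i < a + 2 * m ∧ ext n s i ≠ ext n t i) :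
    (Finset.univ.filter fun h : Fin n → ZMod 2 =>
      ¬∃ t ∈ T, quad a m (ext n h + ext n t) = 0).card * T.card ≤ 2 ^ n := by
  classical
  set B := Finset.univ.filter fun h : Fin n → ZMod 2 =>
      ¬∃ t ∈ T, quad a m (ext n h + ext n t) = 0 with hB
  set f : (Fin n → ZMod 2) → (Fin n → ZMod 2) → ℤ :=
    fun t h => sgn (quad a m (ext n h + ext n t)) with hf
  have h1 : ∑ h, (∑ t ∈ T, f t h) ^ 2 = T.card * 2 ^ n := by
    simp only [sq, Finset.sum_mul_sum]
    rw [Finset.sum_comm]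
    have : ∀ s ∈ T, ∑ h, ∑ t ∈ T, f s h * f t h = 2 ^ n := by
      intro s hs
      rw [Finset.sum_comm, Finset.sum_eq_single_of_mem s hs]
      · have : ∀ h, f s h * f s h = 1 := fun h => by
          simp only [hf]
          generalize quad a m (ext n h + ext n s) = u
          revert u; decide
        simp [this]
      · intro t ht hts
        obtain ⟨i, hai, hi, hne⟩ := hT s hs t ht hts.symm
        exact sum_sgn_quad_eq_zero hn hai hi hne
    rw [Finset.sum_congr rfl this]
    simp
  have h2 : ∀ h ∈ B, (∑ t ∈ T, f t h) ^ 2 = (T.card : ℤ) ^ 2 := by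
    intro h hh
    rw [hB, Finset.mem_filter] at hh
    have : ∀ t ∈ T, f t h = -1 := fun t ht => if_neg fun h0 => hh.2 ⟨t, ht, h0⟩
    rw [Finset.sum_congr rfl this]
    simp
  have h3 : (B.card : ℤ) * (T.card : ℤ) ^ 2 ≤ T.card * 2 ^ n := by
    rw [← h1, ← nsmul_eq_mul, ← Finset.sum_const, ← Finset.sum_congr rfl h2]
    exact Finset.sum_le_sum_of_subset_of_nonneg (Finset.subset_univ _) fun _ _ _ => sq_nonneg _
  rcases Nat.eq_zero_or_pos T.card with h0 | h0
  · simp [h0]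
  · have h4 : (0 : ℤ) < T.card := by exact_mod_cast h0
    have h5 : (B.card : ℤ) * T.card ≤ 2 ^ n := by nlinarith
    exact_mod_cast h5

/-- The common zeros of a sequence of quadratic forms. -/
def zeroSet (a m : ℕ → ℕ) : Set Cantor := {y | ∀ i, quad (a i) (m i) y = 0}

lemma isClosed_zeroSet (a m : ℕ → ℕ) : IsClosed (zeroSet a m) := by
  rw [zeroSet, ofPred_forall]
  exact isClosed_iInter fun i => isClosed_eq (continuous_quad _ _) continuous_const

lemma le_of_succ_eq {a m : ℕ → ℕ} (ha : ∀ k, a (k + 1) = a k + 2 * m k) {i k : ℕ} (hik : i < k) :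
    a i + 2 * m i ≤ a k := by
  rw [← ha]
  exact monotone_nat_of_le_succ (fun k => by rw [ha]; omega) hik

lemma exists_shift_eq_one (u v w : ZMod 2) :
    ((u = 1 ∨ u + v = 1) ∨ u + w = 1) ∨ u + w + (1 + v) = 1 := by
  revert u v w; decide

lemma haar_zeroSet {a m : ℕ → ℕ} (ha : ∀ k, a (k + 1) = a k + 2 * m k) (hm : ∀ k, 0 < m k) :
    haar (zeroSet a m) = 0 := by
  set B : ℕ → Set Cantor := fun n => {y | ∀ i < n, quad (a i) (m i) y = 0} with hB
  have hBm : ∀ n, MeasurableSet (B n) := by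
    intro n
    simp only [hB, ofPred_forall]
    exact (isClosed_iInter fun i => isClosed_iInter fun _ =>
      isClosed_eq (continuous_quad _ _) continuous_const).measurableSet
  have hstep : ∀ n, haar.real (B (n + 1)) ≤ 3 / 4 * haar.real (B n) := by
    intro n
    set D := B n \ B (n + 1) with hD
    have hsub : B (n + 1) ⊆ B n := fun y hy i hi => hy i (by omega)
    have hdiff : haar.real D = haar.real (B n) - haar.real (B (n + 1)) :=
      measureReal_sdiff hsub (hBm _)
    set e : Cantor := Pi.single (a n + 0) 1 with he
    set f : Cantor := Pi.single (a n + m n + 0) 1 with hf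
    have hmemD : ∀ z, z ∈ D ↔ z ∈ B n ∧ quad (a n) (m n) z = 1 := by
      intro z
      have h1 : ∀ u : ZMod 2, u = 1 ↔ u ≠ 0 := by decide
      rw [hD, Set.mem_sdiff, h1]
      refine and_congr_right fun hz => not_congr ⟨fun h => h n (by omega), fun h i hi => ?_⟩
      rcases Nat.lt_succ_iff_lt_or_eq.1 hi with h' | rfl
      exacts [hz i h', h]
    have hinv : ∀ p, a n ≤ p → ∀ z : Cantor, z ∈ B n → Pi.single p 1 + z ∈ B n := by
      intro p hp z hz i hi
      rw [← hz i hi]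
      refine quad_congr fun l _ hl => ?_
      have := le_of_succ_eq ha hi
      have hlp : l ≠ p := by omega
      simp [Pi.single_eq_of_ne hlp]
    have hcover : B n ⊆ ((D ∪ (fun z => e + z) ⁻¹' D) ∪ (fun z => f + z) ⁻¹' D) ∪
        (fun z => e + f + z) ⁻¹' D := by
      intro z hz
      have hfz := hinv (a n + m n + 0) (by omega) z hz
      simp only [mem_union, mem_preimage, hmemD, add_assoc e f z]
      simp only [hz, hfz, hinv (a n + 0) (by omega) z hz, hinv (a n + 0) (by omega) _ hfz, he, hf,
        true_and, quad_single_add_left (hm n), quad_single_add_right (hm n), Pi.add_apply,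
        Pi.single_eq_same]
      exact exists_shift_eq_one _ _ _
    have h4 := (measureReal_mono (μ := haar) hcover).trans ((measureReal_union_le _ _).trans
      (add_le_add_left ((measureReal_union_le _ _).trans
        (add_le_add_left (measureReal_union_le _ _) _)) _))
    rw [haar_preimage_add, haar_preimage_add, haar_preimage_add, hdiff] at h4
    linarith
  have hpow : ∀ n, haar.real (B n) ≤ (3 / 4 : ℝ) ^ n * haar.real univ := by
    intro n
    induction n with
    | zero => simpa using measureReal_mono (subset_univ _)
    | succ n ih =>
      rw [pow_succ]
      linarith [hstep n]
  have hlim : Tendsto (fun n : ℕ => (3 / 4 : ℝ) ^ n * haar.real univ) atTop (𝓝 0) := by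
    simpa using (tendsto_pow_atTop_nhds_zero_of_lt_one (by norm_num : (0 : ℝ) ≤ 3 / 4)
      (by norm_num)).mul_const (haar.real univ)
  exact (measureReal_eq_zero_iff).1 (le_antisymm (ge_of_tendsto' hlim fun n =>
    (measureReal_mono (fun y hy i _ => hy i : zeroSet a m ⊆ B n)).trans (hpow n)) measureReal_nonneg)

/-- The points whose sum with some point of `S` is a zero of the quadratic forms with indices
`k, …, k + j - 1`. -/
def reach (a m : ℕ → ℕ) (k j : ℕ) (S : Set Cantor) : Set Cantor :=
  {z | ∃ x ∈ S, ∀ i, k ≤ i → i < k + j → quad (a i) (m i) (z + x) = 0}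

lemma measurableSet_reach (a m : ℕ → ℕ) (k j : ℕ) (S : Set Cantor) :
    MeasurableSet (reach a m k j S) := by
  have h : reach a m k j S = ⋃ x ∈ S, ⋂ i ∈ Ico k (k + j),
      (fun z => quad (a i) (m i) (z + x)) ⁻¹' {0} := by
    ext z
    simp [reach]
  rw [h]
  refine (isOpen_biUnion fun x _ => (finite_Ico k (k + j)).isOpen_biInter fun i _ => ?_).measurableSet
  exact (isOpen_discrete {0}).preimage ((continuous_quad _ _).comp (continuous_id.add continuous_const))

lemma reach_congr {a m : ℕ → ℕ} (ha : ∀ k, a (k + 1) = a k + 2 * m k) (k j : ℕ) (S : Set Cantor)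
    (z z' : Cantor) (hz : ∀ i, a k ≤ i → z i = z' i) (h : z ∈ reach a m k j S) :
    z' ∈ reach a m k j S := by
  obtain ⟨x, hx, hxi⟩ := h
  refine ⟨x, hx, fun i hki hij => ?_⟩
  rw [← hxi i hki hij]
  refine quad_congr fun l hl _ => ?_
  have hak : a k ≤ a i := monotone_nat_of_le_succ (fun k => by rw [ha]; omega) hki
  simp [hz l (hak.trans hl)]

/-- Inside a cylinder of length `a k`, either `ν` is small on `S`, or the set reached from `S` has a
large measure, uniformly in `j`. -/
lemma small_or_reach_large {a m : ℕ → ℕ} (ha : ∀ k, a (k + 1) = a k + 2 * m k)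
    {ν : Set Cantor → ℝ} (hν0 : ν ∅ = 0) (hνmono : ∀ {A B}, A ⊆ B → ν A ≤ ν B)
    (hνsum : ∀ (n : ℕ) (A : (Fin n → ZMod 2) → Set Cantor), ν (⋃ w, A w) ≤ ∑ w, ν (A w))
    (hν : ∀ k w, ν (fib (a (k + 1)) w) * (2 ^ a k * (k + 2) ^ 2) ≤ (1 / 2) ^ k)
    (j k : ℕ) (w : Fin (a k) → ZMod 2) (S : Set Cantor) (hS : S ⊆ fib (a k) w) :
    ν S * 2 ^ a k ≤ 2 * (1 / 2) ^ k ∨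
      haar.real univ * ((k + 1) / (k + 2)) ≤ haar.real (reach a m k j S) := by
  classical
  induction j generalizing k S with
  | zero =>
    rcases S.eq_empty_or_nonempty with rfl | ⟨x, hx⟩
    · left
      rw [hν0, zero_mul]
      positivity
    · right
      have : reach a m k 0 S = univ := eq_univ_of_forall fun z => ⟨x, hx, fun i _ _ => by omega⟩
      rw [this]
      refine mul_le_of_le_one_right haar_univ_pos.le ?_
      rw [div_le_one (by positivity)]
      linarith
  | succ j ih =>
    set n := a (k + 1) with hn
    have hnk : n = a k + 2 * m k := ha k
    set p : ℝ := haar.real univ * (((k + 1 : ℕ) + 1) / ((k + 1 : ℕ) + 2)) with hp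
    have hp0 : 0 < p := mul_pos haar_univ_pos (by positivity)
    set T : Finset (Fin n → ZMod 2) := Finset.univ.filter fun t =>
      p ≤ haar.real (reach a m (k + 1) j (S ∩ fib n t)) with hT
    have hTne : ∀ t ∈ T, (S ∩ fib n t).Nonempty := by
      intro t ht
      by_contra hne
      rw [not_nonempty_iff_eq_empty] at hne
      have h1 : reach a m (k + 1) j (S ∩ fib n t) = ∅ := by
        rw [hne]; simp [reach]
      have h2 := (Finset.mem_filter.1 ht).2
      rw [h1, measureReal_empty] at h2
      linarith
    have hpre : ∀ t, (S ∩ fib n t).Nonempty → ∀ i, ∀ hi : i < a k,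
        ext n t i = w ⟨i, hi⟩ := by
      rintro t ⟨x, hxS, hxt⟩ i hi
      rw [← mem_fib.1 hxt, ← mem_fib.1 (hS hxS), ext_res_apply _ (by omega)]
      rfl
    rcases le_or_gt ((k + 2) ^ 2) T.card with hcard | hcard
    · right
      set G := Finset.univ.filter fun h : Fin n → ZMod 2 =>
        ∃ t ∈ T, quad (a k) (m k) (ext n h + ext n t) = 0 with hG
      have hbad := card_bad_mul_le (a := a k) (m := m k) hnk.ge T (by
        intro s hs t ht hst
        by_contra! hall
        refine hst (funext fun i => ?_)
        have hi := i.2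
        rw [← ext_apply_of_lt s i.2, ← ext_apply_of_lt t i.2]
        rcases lt_or_ge (i : ℕ) (a k) with h | h
        · rw [hpre s (hTne s hs) i h, hpre t (hTne t ht) i h]
        · exact hall i h (by omega))
      have hadd := Finset.card_filter_add_card_filter_not (s := Finset.univ)
        fun h : Fin n → ZMod 2 => ∃ t ∈ T, quad (a k) (m k) (ext n h + ext n t) = 0
      rw [← hG, Finset.card_univ, Fintype.card_fun, ZMod.card, Fintype.card_fin] at hadd
      have hGcard : (2 : ℝ) ^ n * ((k + 1) * (k + 3)) ≤ G.card * (k + 2) ^ 2 := by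
        have h1 := (Nat.mul_le_mul_left _ hcard).trans hbad
        have h2 : ((Finset.univ.filter fun h : Fin n → ZMod 2 =>
          ¬∃ t ∈ T, quad (a k) (m k) (ext n h + ext n t) = 0).card : ℝ) * (k + 2) ^ 2 ≤ 2 ^ n := by
          exact_mod_cast h1
        have h3 : (G.card : ℝ) + ((Finset.univ.filter fun h : Fin n → ZMod 2 =>
          ¬∃ t ∈ T, quad (a k) (m k) (ext n h + ext n t) = 0).card : ℝ) = 2 ^ n := by
          exact_mod_cast hadd
        rw [← h3] at h2 ⊢
        nlinarith
      have hslice : ∀ h ∈ G, p / 2 ^ n ≤ haar.real (reach a m k (j + 1) S ∩ fib n h) := by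
        intro h hh
        obtain ⟨t, ht, hth⟩ := (Finset.mem_filter.1 hh).2
        have hsub : reach a m (k + 1) j (S ∩ fib n t) ∩ fib n h ⊆
            reach a m k (j + 1) S ∩ fib n h := by
          rintro z ⟨⟨x, ⟨hxS, hxt⟩, hx⟩, hz⟩
          refine ⟨⟨x, hxS, fun i hki hij => ?_⟩, hz⟩
          rcases hki.eq_or_lt with rfl | hki
          · rw [← hth, ← mem_fib.1 hxt, ← mem_fib.1 hz]
            refine quad_congr fun l _ hl => ?_
            simp only [Pi.add_apply]
            rw [ext_res_apply _ (by omega), ext_res_apply _ (by omega)]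
          · exact hx i hki (by omega)
        refine le_trans ?_ (measureReal_mono hsub)
        rw [div_le_iff₀ (by positivity), haar_inter_fib n (measurableSet_reach _ _ _ _ _)
          (reach_congr ha _ _ _)]
        exact (Finset.mem_filter.1 ht).2
      rw [haar_eq_sum n (measurableSet_reach _ _ _ _ _)]
      refine le_trans ?_ (Finset.sum_le_sum_of_subset_of_nonneg (Finset.subset_univ G)
        fun _ _ _ => measureReal_nonneg)
      refine le_trans ?_ (Finset.sum_le_sum hslice)
      rw [Finset.sum_const, nsmul_eq_mul, hp, mul_div_assoc (haar.real univ), mul_left_comm]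
      refine mul_le_mul_of_nonneg_left ?_ haar_univ_pos.le
      push_cast
      rw [div_div, mul_div_assoc', div_le_div_iff₀ (by positivity) (by positivity)]
      nlinarith
    · left
      set N : Finset (Fin n → ZMod 2) := Finset.univ.filter fun t => (S ∩ fib n t).Nonempty with hN
      have hNcard : N.card ≤ 2 ^ (2 * m k) := by
        have h1 : N.card ≤ (Finset.univ : Finset (Fin (2 * m k) → ZMod 2)).card := by
          refine Finset.card_le_card_of_injOn (fun t l => ext n t (a k + l))
            (fun _ _ => Finset.mem_coe.2 (Finset.mem_univ _)) ?_
          intro s hs t ht hst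
          have hs' := (Finset.mem_filter.1 hs).2
          have ht' := (Finset.mem_filter.1 ht).2
          refine funext fun i => ?_
          have hi := i.2
          rw [← ext_apply_of_lt s i.2, ← ext_apply_of_lt t i.2]
          rcases lt_or_ge (i : ℕ) (a k) with h | h
          · rw [hpre s hs' i h, hpre t ht' i h]
          · obtain ⟨l, hl⟩ := Nat.exists_eq_add_of_le h
            rw [hl]
            exact congrFun hst ⟨l, by omega⟩
        simpa [ZMod.card] using h1
      have hsum : ν S ≤ ∑ t ∈ N, ν (S ∩ fib n t) := by
        have h1 : S ⊆ ⋃ t, S ∩ fib n t := fun x hx => mem_iUnion.2 ⟨res n x, hx, rfl⟩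
        refine (hνmono h1).trans ((hνsum n _).trans (le_of_eq ?_))
        refine (Finset.sum_subset (Finset.subset_univ N) fun t _ ht => ?_).symm
        have : S ∩ fib n t = ∅ := by
          by_contra hne
          exact ht (Finset.mem_filter.2 ⟨Finset.mem_univ _, nonempty_iff_ne_empty.2 hne⟩)
        rw [this, hν0]
      have hterm : ∀ t, ν (S ∩ fib n t) * 2 ^ a k ≤
          (if t ∈ T then (1 / 2 : ℝ) ^ k / ((k : ℝ) + 2) ^ 2 else 0) + (1 / 2) ^ k / 2 ^ (2 * m k) := by
        intro t
        split_ifs with ht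
        · refine le_add_of_le_of_nonneg ?_ (by positivity)
          rw [le_div_iff₀ (by positivity), mul_assoc]
          exact (mul_le_mul_of_nonneg_right (hνmono inter_subset_right) (by positivity)).trans
            (hν k t)
        · rw [zero_add, le_div_iff₀ (by positivity), mul_assoc, ← pow_add, ← hnk]
          have hnot : ¬ p ≤ haar.real (reach a m (k + 1) j (S ∩ fib n t)) :=
            fun h => ht (Finset.mem_filter.2 ⟨Finset.mem_univ _, h⟩)
          have := (ih (k + 1) t (S ∩ fib n t) inter_subset_right).resolve_right hnot
          rw [pow_succ (1 / 2 : ℝ)] at this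
          linarith
      have hTsum : (T.card : ℝ) * ((1 / 2) ^ k / (k + 2) ^ 2) ≤ (1 / 2) ^ k := by
        rw [mul_div_assoc', div_le_iff₀ (by positivity), mul_comm]
        refine mul_le_mul_of_nonneg_left ?_ (by positivity)
        exact_mod_cast hcard.le
      have hNsum : (N.card : ℝ) * ((1 / 2) ^ k / 2 ^ (2 * m k)) ≤ (1 / 2) ^ k := by
        rw [mul_div_assoc', div_le_iff₀ (by positivity), mul_comm]
        refine mul_le_mul_of_nonneg_left ?_ (by positivity)
        exact_mod_cast hNcard
      have hTN : ∑ t ∈ N, (if t ∈ T then (1 / 2 : ℝ) ^ k / ((k : ℝ) + 2) ^ 2 else 0) ≤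
          (T.card : ℝ) * ((1 / 2) ^ k / ((k : ℝ) + 2) ^ 2) := by
        rw [← nsmul_eq_mul, ← Finset.sum_const, ← Finset.sum_filter]
        refine Finset.sum_le_sum_of_subset_of_nonneg (fun t ht => (Finset.mem_filter.1 ht).2) ?_
        intros
        positivity
      calc ν S * 2 ^ a k ≤ ∑ t ∈ N, ν (S ∩ fib n t) * 2 ^ a k := by
            rw [← Finset.sum_mul]
            exact mul_le_mul_of_nonneg_right hsum (by positivity)
        _ ≤ _ := Finset.sum_le_sum fun t _ => hterm t
        _ ≤ 2 * (1 / 2) ^ k := by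
            rw [Finset.sum_add_distrib, Finset.sum_const, nsmul_eq_mul]
            linarith

lemma reach_inter_fib_subset {a m : ℕ → ℕ} (ha : ∀ k, a (k + 1) = a k + 2 * m k) {k j n : ℕ}
    (hn : n ≤ a k) {S F : Set Cantor} {w : Fin (a k) → ZMod 2} (hS : S ⊆ fib (a k) w) {s : Cantor}
    (hs : s ∈ zeroSet a m) (hF : ∀ x ∈ S, ∀ y ∈ zeroSet a m, res n y = res n s → x + y ∈ F) :
    reach a m k j S ∩ fib (a k) (w + res (a k) s) ⊆ nbhd F (a (k + j)) := by
  rintro z ⟨⟨x, hx, hxz⟩, hz⟩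
  have hmono : Monotone a := monotone_nat_of_le_succ fun k => by rw [ha]; omega
  have hkj : a k ≤ a (k + j) := hmono (Nat.le_add_right k j)
  set y : Cantor := fun i => if i < a k then s i else if i < a (k + j) then z i + x i else 0 with hy
  have hyE : y ∈ zeroSet a m := by
    intro i
    rcases lt_or_ge i k with hik | hki
    · have := le_of_succ_eq ha hik
      rw [← hs i]
      refine quad_congr fun l _ hl => if_pos (by omega)
    · have h1 := hmono hki
      rcases lt_or_ge i (k + j) with hij | hij
      · have := le_of_succ_eq ha hij
        rw [← hxz i hki hij]
        refine quad_congr fun l hl hl' => ?_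
        rw [hy]
        dsimp only
        rw [if_neg (by omega), if_pos (by omega)]
        rfl
      · have h2 := hmono hij
        rw [← quad_zero (a i) (m i)]
        refine quad_congr fun l hl hl' => ?_
        rw [hy]
        dsimp only
        rw [if_neg (by omega), if_neg (by omega)]
        rfl
  refine ⟨x + y, hF x hx y hyE (res_eq_iff.2 fun i hi => if_pos (by omega)),
    res_eq_iff.2 fun i hi => ?_⟩
  rw [Pi.add_apply, hy]
  dsimp only
  split_ifs with h1
  · have h2 := congrFun (mem_fib.1 hz) ⟨i, h1⟩
    rw [← mem_fib.1 (hS hx)] at h2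
    exact h2
  · exact (add_add_self _ _).symm

/-- The image of the product of a cylinder and `C` under a Lipschitz map is controlled by the size
of a neighbourhood of `C`. -/
lemma haar_image_fib_prod_le {K : NNReal} {φ : Cantor × Cantor → Cantor} (hφ : LipschitzWith K φ)
    {e : ℕ} (he : (K : ℝ) ≤ 2 ^ e) (C : Set Cantor) (n : ℕ) (w : Fin n → ZMod 2) :
    haar.real (φ '' (fib n w ×ˢ C)) ≤ 2 ^ e * haar.real (nbhd C n) := by
  classical
  have hex : ∀ v : Fin n → ZMod 2, ∃ y : Cantor, v ∈ res n '' C → res n y = v := fun v =>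
    ⟨ext n v, fun _ => res_ext n v⟩
  choose y hy using hex
  set c : (Fin n → ZMod 2) → Cantor := fun v => φ (ext n w, y v) with hc
  have hsub : φ '' (fib n w ×ˢ C) ⊆ ⋃ v ∈ (res n '' C).toFinset, fib (n - e) (res (n - e) (c v)) := by
    rintro _ ⟨⟨x, z⟩, ⟨hx, hz⟩, rfl⟩
    have hzv : res n z ∈ res n '' C := ⟨z, hz, rfl⟩
    refine mem_iUnion₂.2 ⟨res n z, by simpa using hzv, ?_⟩
    rw [mem_fib, res_eq_iff]
    rcases le_or_gt n e with hne | hne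
    · intro i hi
      omega
    · refine PiNat.mem_cylinder_iff_dist_le.2 ?_
      have h1 : dist x (ext n w) ≤ (1 / 2) ^ n := PiNat.mem_cylinder_iff_dist_le.1
        fun i hi => res_eq_iff.1 ((mem_fib.1 hx).trans (res_ext n w).symm) i hi
      have h2 : dist z (y (res n z)) ≤ (1 / 2) ^ n := PiNat.mem_cylinder_iff_dist_le.1
        fun i hi => res_eq_iff.1 (hy _ hzv).symm i hi
      refine (hφ.dist_le_mul _ _).trans ?_
      rw [Prod.dist_eq]
      refine (mul_le_mul he (max_le h1 h2) (le_max_of_le_left dist_nonneg) (by positivity)).trans ?_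
      obtain ⟨d, rfl⟩ := Nat.exists_eq_add_of_lt hne
      rw [show e + d + 1 - e = d + 1 by omega, show e + d + 1 = e + (d + 1) by omega, pow_add,
        ← mul_assoc, ← mul_pow]
      norm_num
  have hterm : ∀ v, haar.real (fib (n - e) v) * 2 ^ n ≤ 2 ^ e * haar.real univ := by
    intro v
    rw [← haar_fib (n - e) v, mul_left_comm, ← pow_add]
    exact mul_le_mul_of_nonneg_left (pow_le_pow_right₀ (by norm_num) (by omega)) measureReal_nonneg
  refine le_of_mul_le_mul_right ?_ (by positivity : (0 : ℝ) < 2 ^ n)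
  rw [mul_assoc, haar_nbhd, Set.ncard_eq_toFinset_card', mul_left_comm, ← nsmul_eq_mul,
    ← Finset.sum_const]
  refine (mul_le_mul_of_nonneg_right ((measureReal_mono hsub (measure_ne_top _ _)).trans
    (measureReal_biUnion_finset_le _ _)) (by positivity)).trans ?_
  rw [Finset.sum_mul]
  exact Finset.sum_le_sum fun v _ => hterm _

/-- A Baire category argument: if countably many closed sets cover a translate of a closed set `Z`,
one of them contains the corresponding translate of a nonempty portion of `Z`. -/
lemma exists_portion_subset {Z : Set Cantor} (hZ : IsClosed Z) (hne : Z.Nonempty)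
    {F : ℕ → Set Cantor} (hF : ∀ j, IsClosed (F j)) {x : Cantor} (hx : ∀ y ∈ Z, x + y ∈ ⋃ j, F j) :
    ∃ j n, ∃ s ∈ Z, ∀ y ∈ Z, res n y = res n s → x + y ∈ F j := by
  have : CompactSpace Z := isCompact_iff_compactSpace.1 hZ.isCompact
  have : Nonempty Z := hne.to_subtype
  have hcont : Continuous fun y : Z => x + (y : Cantor) :=
    continuous_const.add continuous_subtype_val
  obtain ⟨j, s, hs⟩ := nonempty_interior_of_iUnion_of_closed
    (f := fun j => (fun y : Z => x + (y : Cantor)) ⁻¹' F j) (fun j => (hF j).preimage hcont) (by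
      refine eq_univ_of_forall fun y => ?_
      simpa using hx y y.2)
  obtain ⟨U, hU, hUi⟩ := isOpen_induced_iff.1
    (isOpen_interior (s := (fun y : Z => x + (y : Cantor)) ⁻¹' F j))
  rw [← hUi] at hs
  obtain ⟨n, hn⟩ := exists_fib_subset hU hs
  refine ⟨j, n, s, s.2, fun y hy hys => ?_⟩
  have h1 : (⟨y, hy⟩ : Z) ∈ Subtype.val ⁻¹' U := hn hys
  rw [hUi] at h1
  exact interior_subset (s := (fun y : Z => x + (y : Cantor)) ⁻¹' F j) h1

lemma exists_fast_sequence {u : ℕ → ℝ} (hu : Tendsto u atTop (𝓝 0)) :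
    ∃ a m : ℕ → ℕ, (∀ k, a (k + 1) = a k + 2 * m k) ∧ (∀ k, 0 < m k) ∧
      ∀ k, u (a (k + 1)) * (2 ^ a k * (k + 2) ^ 2) ≤ (1 / 2) ^ k := by
  have h : ∀ k α : ℕ, ∃ M, ∀ n ≥ M, u n * (2 ^ α * ((k : ℝ) + 2) ^ 2) ≤ (1 / 2) ^ k := by
    intro k α
    have h1 : Tendsto (fun n => u n * (2 ^ α * ((k : ℝ) + 2) ^ 2)) atTop (𝓝 0) := by
      simpa using hu.mul_const (2 ^ α * ((k : ℝ) + 2) ^ 2)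
    exact eventually_atTop.1 (h1.eventually (ge_mem_nhds (by positivity)))
  choose M hM using h
  set a : ℕ → ℕ := fun k => Nat.rec 0 (fun k α => α + 2 * (M k α + 1)) k with ha
  have hs : ∀ k, a (k + 1) = a k + 2 * (M k (a k) + 1) := fun k => rfl
  exact ⟨a, fun k => M k (a k) + 1, hs, fun k => Nat.succ_pos _,
    fun k => hM k (a k) _ (by rw [hs]; omega)⟩

/-- If all translates by `x ∈ Q` of a portion of `zeroSet a m` lie in the null closed set `F`, then
`ν Q` vanishes. -/
lemma eq_zero_of_add_subset {a m : ℕ → ℕ} (ha : ∀ k, a (k + 1) = a k + 2 * m k)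
    (hamono : StrictMono a) {ν : Set Cantor → ℝ} (hν0 : ν ∅ = 0)
    (hνmono : ∀ {A B}, A ⊆ B → ν A ≤ ν B)
    (hνsum : ∀ (n : ℕ) (A : (Fin n → ZMod 2) → Set Cantor), ν (⋃ w, A w) ≤ ∑ w, ν (A w))
    (hν : ∀ k w, ν (fib (a (k + 1)) w) * (2 ^ a k * (k + 2) ^ 2) ≤ (1 / 2) ^ k)
    {F : Set Cantor} (hF : IsClosed F) (hF0 : haar F = 0) {n : ℕ} {s : Cantor}
    (hs : s ∈ zeroSet a m) {Q : Set Cantor}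
    (hQ : ∀ x ∈ Q, ∀ y ∈ zeroSet a m, res n y = res n s → x + y ∈ F) : ν Q = 0 := by
  have hbound : ∀ k, n ≤ k → ν Q ≤ 2 * (1 / 2) ^ k := by
    intro k hk
    have hsmall : ∀ w : Fin (a k) → ZMod 2, ν (Q ∩ fib (a k) w) * 2 ^ a k ≤ 2 * (1 / 2) ^ k := by
      intro w
      have hpos : 0 < haar.real univ * ((k + 1) / (k + 2)) / 2 ^ a k := by
        have := haar_univ_pos
        positivity
      obtain ⟨N, hN⟩ := eventually_atTop.1
        ((tendsto_haar_nbhd hF hF0).eventually (gt_mem_nhds hpos))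
      refine (small_or_reach_large ha hν0 hνmono hνsum hν N k w (Q ∩ fib (a k) w)
        inter_subset_right).resolve_right fun hlarge => ?_
      have h1 := hN (a (k + N)) ((Nat.le_add_left N k).trans hamono.le_apply)
      have h2 : reach a m k N (Q ∩ fib (a k) w) ∩ fib (a k) (w + res (a k) s) ⊆
          nbhd F (a (k + N)) :=
        reach_inter_fib_subset ha (hk.trans hamono.le_apply) inter_subset_right hs
          fun x hx y hy hys => hQ x hx.1 y hy hys
      have h3 := haar_inter_fib (a k) (measurableSet_reach a m k N (Q ∩ fib (a k) w))
        (reach_congr ha k N _) (w + res (a k) s)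
      rw [lt_div_iff₀ (by positivity)] at h1
      have h4 := mul_le_mul_of_nonneg_right (measureReal_mono (μ := haar) h2)
        (by positivity : (0 : ℝ) ≤ 2 ^ a k)
      linarith
    have hcov : Q ⊆ ⋃ w, Q ∩ fib (a k) w := fun x hx => mem_iUnion.2 ⟨res (a k) x, hx, rfl⟩
    refine le_of_mul_le_mul_right ?_ (by positivity : (0 : ℝ) < 2 ^ a k)
    calc ν Q * 2 ^ a k ≤ (∑ w, ν (Q ∩ fib (a k) w)) * 2 ^ a k :=
          mul_le_mul_of_nonneg_right ((hνmono hcov).trans (hνsum _ _)) (by positivity)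
      _ = ∑ w, ν (Q ∩ fib (a k) w) * 2 ^ a k := Finset.sum_mul _ _ _
      _ ≤ ∑ _w : Fin (a k) → ZMod 2, 2 * (1 / 2) ^ k := Finset.sum_le_sum fun w _ => hsmall w
      _ = 2 * (1 / 2) ^ k * 2 ^ a k := by simp [mul_comm]
  have hlim : Tendsto (fun k : ℕ => 2 * (1 / 2 : ℝ) ^ k) atTop (𝓝 0) := by
    simpa using (tendsto_pow_atTop_nhds_zero_of_lt_one (by norm_num : (0 : ℝ) ≤ 1 / 2)
      (by norm_num)).const_mul 2
  exact le_antisymm (ge_of_tendsto hlim (eventually_atTop.2 ⟨n, hbound⟩))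
    (hν0 ▸ hνmono (empty_subset Q))

lemma memE_image_prod_of_isClosed {X : Set Cantor} (hX : ∀ E : Set Cantor, MemE E → MemE (X + E))
    {C : Set Cantor} (hC : IsClosed C) (hC0 : haar C = 0) {K : NNReal}
    {φ : Cantor × Cantor → Cantor} (hφ : LipschitzWith K φ) : MemE (φ '' (X ×ˢ C)) := by
  obtain ⟨e, he⟩ := pow_unbounded_of_one_lt (K : ℝ) (by norm_num : (1 : ℝ) < 2)
  have hlim : Tendsto (fun n => 2 ^ e * haar.real (nbhd C n)) atTop (𝓝 0) := by
    simpa using (tendsto_haar_nbhd hC hC0).const_mul ((2 : ℝ) ^ e)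
  obtain ⟨a, m, ha, hm, hau⟩ := exists_fast_sequence hlim
  have hamono : StrictMono a := strictMono_nat_of_lt_succ fun k => by
    have := hm k
    rw [ha]
    omega
  set ν : Set Cantor → ℝ := fun S => haar.real (φ '' (S ×ˢ C)) with hν
  have hν0 : ν ∅ = 0 := by simp [hν]
  have hνmono : ∀ {A B : Set Cantor}, A ⊆ B → ν A ≤ ν B := fun h =>
    measureReal_mono (image_mono (prod_mono_left h))
  have hνsum : ∀ (n : ℕ) (A : (Fin n → ZMod 2) → Set Cantor), ν (⋃ w, A w) ≤ ∑ w, ν (A w) := by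
    intro n A
    simp only [hν]
    rw [iUnion_prod_const, image_iUnion]
    exact measureReal_iUnion_fintype_le _
  have hνfib : ∀ k w, ν (fib (a (k + 1)) w) * (2 ^ a k * (k + 2) ^ 2) ≤ (1 / 2) ^ k :=
    fun k w => (mul_le_mul_of_nonneg_right (haar_image_fib_prod_le hφ he.le C _ w)
      (by positivity)).trans (hau k)
  obtain ⟨_, hXF, hF0, F, hF, rfl⟩ := hX (zeroSet a m)
    (memE_of_isClosed (isClosed_zeroSet a m) (haar_zeroSet ha hm))
  have hFj0 : ∀ j, haar (F j) = 0 := measure_iUnion_null_iff.1 hF0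
  set P : ℕ × (Σ n, Fin n → ZMod 2) → Set Cantor := fun p =>
    {x | ∀ y ∈ zeroSet a m ∩ fib p.2.1 p.2.2, x + y ∈ F p.1} with hP
  have hPclosed : ∀ p, IsClosed (P p) := by
    intro p
    simp only [hP, ofPred_forall]
    exact isClosed_iInter fun y => isClosed_iInter fun _ =>
      (hF p.1).preimage (continuous_id.add continuous_const)
  have hnull : ∀ p, (zeroSet a m ∩ fib p.2.1 p.2.2).Nonempty → haar (φ '' (P p ×ˢ C)) = 0 := by
    rintro p ⟨s, hs, hsv⟩
    refine (measureReal_eq_zero_iff (measure_ne_top _ _)).1 ?_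
    exact eq_zero_of_add_subset ha hamono hν0 hνmono hνsum hνfib (hF p.1) (hFj0 p.1) hs
      fun x hx y hy hys => hx y ⟨hy, hys.trans hsv⟩
  have hclosed : ∀ p, IsClosed (φ '' (P p ×ˢ C)) := fun p =>
    (((hPclosed p).isCompact.prod hC.isCompact).image hφ.continuous).isClosed
  set G : Set (ℕ × (Σ n, Fin n → ZMod 2)) :=
    {p | (zeroSet a m ∩ fib p.2.1 p.2.2).Nonempty} with hG
  have hmem : ∀ p : G, MemE (φ '' (P p ×ˢ C)) := fun p =>
    memE_of_isClosed (hclosed p) (hnull p p.2)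
  refine memE_mono (memE_iUnion hmem) ?_
  rintro _ ⟨⟨x, c⟩, ⟨hx, hc⟩, rfl⟩
  obtain ⟨j, n, s, hs, hsF⟩ := exists_portion_subset (isClosed_zeroSet a m)
    ⟨0, fun i => quad_zero _ _⟩ hF (x := x) fun y hy => hXF (Set.add_mem_add hx hy)
  exact mem_iUnion.2 ⟨⟨⟨j, n, res n s⟩, s, hs, rfl⟩, ⟨x, c⟩, ⟨fun y hy => hsF y hy.1 hy.2, hc⟩, rfl⟩

end CantorAux

/-- If `X ⊆ 2^ℕ` is `𝔈`-additive, then `φ '' (X ×ˢ E) ∈ 𝔈` for every `E ∈ 𝔈` and every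
Lipschitz map `φ : 2^ℕ × 2^ℕ → 2^ℕ` (maximum metric on the product). -/
theorem stmt13 (X : Set Cantor) (hX : ∀ E : Set Cantor, MemE E → MemE (X + E))
    (E : Set Cantor) (hE : MemE E) (K : NNReal) (φ : Cantor × Cantor → Cantor)
    (hφ : LipschitzWith K φ) : MemE (φ '' (X ×ˢ E)) := by
  obtain ⟨F, hEF, hF0, C, hC, rfl⟩ := hE
  refine CantorAux.memE_mono (CantorAux.memE_iUnion fun n =>
    CantorAux.memE_image_prod_of_isClosed hX (hC n) (MeasureTheory.measure_iUnion_null_iff.1 hF0 n)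
      hφ) ?_
  rw [← Set.image_iUnion, ← Set.prod_iUnion]
  exact Set.image_mono (Set.prod_mono_right hEF)
end

section
/- A set X ⊆ 2^ℕ × 2^ℕ is meager-additive in the product group 2^ℕ × 2^ℕ if and only if X has sharp measure zero with respect to the maximum metric on 2^ℕ × 2^ℕ (each factor carrying the least-difference metric). -/
open MeasureTheory Set Filter Pointwise
open scoped ENNReal NNReal Topology

/-- A gauge: a nondecreasing, right-continuous function `h : [0,∞) → [0,∞]` with `h 0 = 0`
and `h r > 0` for `r > 0`. -/
def IsGauge (h : ℝ≥0∞ → ℝ≥0∞) : Prop :=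
  Monotone h ∧ (∀ r : ℝ≥0∞, Filter.Tendsto h (nhdsWithin r (Set.Ioi r)) (nhds (h r))) ∧
    h 0 = 0 ∧ ∀ r : ℝ≥0∞, 0 < r → 0 < h r

/-- `X` has strong measure zero: for every sequence of positive reals `ε n` there is a
countable cover `U n` of `X` with `diam (U n) ≤ ε n` for all `n`. -/
def HasSMZ (X : Type*) [MetricSpace X] : Prop :=
  ∀ ε : ℕ → ℝ, (∀ n, 0 < ε n) →
    ∃ U : ℕ → Set X, (∀ x : X, ∃ n, x ∈ U n) ∧
      ∀ n, EMetric.diam (U n) ≤ ENNReal.ofReal (ε n)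

/-- `⟨U n⟩` is a γ-groupable cover of `E`: there is a strictly increasing sequence
`0 = k 0 < k 1 < ⋯` such that every `x ∈ E` belongs to `⋃_{k j ≤ n < k (j+1)} U n`
for all but finitely many `j`. -/
def IsGammaGroupable {X : Type*} (U : ℕ → Set X) (E : Set X) : Prop :=
  ∃ k : ℕ → ℕ, k 0 = 0 ∧ StrictMono k ∧
    ∀ x ∈ E, ∀ᶠ j in Filter.atTop, ∃ n, k j ≤ n ∧ n < k (j + 1) ∧ x ∈ U n

/-- A set `E` in a metric space has sharp measure zero: for every sequence of positive reals
`ε n` it admits a γ-groupable cover `U n` with `diam (U n) ≤ ε n` for all `n`. -/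
def IsSSMZ {X : Type*} [MetricSpace X] (E : Set X) : Prop :=
  ∀ ε : ℕ → ℝ, (∀ n, 0 < ε n) →
    ∃ U : ℕ → Set X, IsGammaGroupable U E ∧
      ∀ n, EMetric.diam (U n) ≤ ENNReal.ofReal (ε n)

/-- A metric space has sharp measure zero. -/
def HasSSMZ (X : Type*) [MetricSpace X] : Prop := IsSSMZ (Set.univ : Set X)

/-- `p` and `q` have the same coordinates in the interval `[a, b)`. -/
def AgreeOn (a b : ℕ) (p q : Cantor × Cantor) : Prop :=
  ∀ i, a ≤ i → i < b → p.1 i = q.1 i ∧ p.2 i = q.2 i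

lemma AgreeOn.symm {a b : ℕ} {p q : Cantor × Cantor} (h : AgreeOn a b p q) : AgreeOn a b q p :=
  fun i h₁ h₂ => ⟨(h i h₁ h₂).1.symm, (h i h₁ h₂).2.symm⟩

lemma AgreeOn.trans {a b : ℕ} {p q r : Cantor × Cantor} (h : AgreeOn a b p q)
    (h' : AgreeOn a b q r) : AgreeOn a b p r :=
  fun i h₁ h₂ => ⟨(h i h₁ h₂).1.trans (h' i h₁ h₂).1, (h i h₁ h₂).2.trans (h' i h₁ h₂).2⟩

lemma AgreeOn.mono {a b a' b' : ℕ} {p q : Cantor × Cantor} (h : AgreeOn a b p q)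
    (ha : a ≤ a') (hb : b' ≤ b) : AgreeOn a' b' p q :=
  fun i h₁ h₂ => h i (ha.trans h₁) (h₂.trans_le hb)

lemma AgreeOn.append {a b c : ℕ} {p q : Cantor × Cantor} (h : AgreeOn a b p q)
    (h' : AgreeOn b c p q) : AgreeOn a c p q := fun i h₁ h₂ =>
  (lt_or_ge i b).elim (fun hi => h i h₁ hi) (fun hi => h' i hi h₂)

lemma agreeOn_zero_iff_dist_le {b : ℕ} {p q : Cantor × Cantor} :
    AgreeOn 0 b p q ↔ dist p q ≤ (1 / 2 : ℝ) ^ b := by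
  have h (x y : Cantor) : dist x y ≤ (1 / 2 : ℝ) ^ b ↔ ∀ i < b, x i = y i :=
    (PiNat.mem_cylinder_iff_dist_le (E := fun _ => ZMod 2)).symm
  rw [Prod.dist_eq, max_le_iff, h, h]
  exact ⟨fun H => ⟨fun i hi => (H i i.zero_le hi).1, fun i hi => (H i i.zero_le hi).2⟩,
    fun H i _ hi => ⟨H.1 i hi, H.2 i hi⟩⟩

lemma isOpen_setOf_agreeOn (a b : ℕ) (z : Cantor × Cantor) : IsOpen {w | AgreeOn a b w z} := by
  have : {w | AgreeOn a b w z} =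
      ⋂ i ∈ Finset.Ico a b, {w : Cantor × Cantor | w.1 i = z.1 i} ∩ {w | w.2 i = z.2 i} := by
    ext w
    simp [AgreeOn]
  rw [this]
  refine isOpen_biInter_finset fun i _ => IsOpen.inter ?_ ?_
  · exact (isOpen_discrete {z.1 i}).preimage (by fun_prop : Continuous
      fun w : Cantor × Cantor => w.1 i)
  · exact (isOpen_discrete {z.2 i}).preimage (by fun_prop : Continuous
      fun w : Cantor × Cantor => w.2 i)

lemma exists_agreeOn_subset {V : Set (Cantor × Cantor)} (hV : IsOpen V) {v : Cantor × Cantor}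
    (hv : v ∈ V) : ∃ b, ∀ w, AgreeOn 0 b w v → w ∈ V := by
  obtain ⟨r, hr, hball⟩ := Metric.isOpen_iff.1 hV v hv
  obtain ⟨b, hb⟩ := exists_pow_lt_of_lt_one hr (by norm_num : (1 / 2 : ℝ) < 1)
  exact ⟨b, fun w hw => hball ((agreeOn_zero_iff_dist_le.1 hw).trans_lt hb)⟩

lemma exists_mem_block {f : ℕ → ℕ} (hf : StrictMono f) (h0 : f 0 = 0) (i : ℕ) :
    ∃ n, f n ≤ i ∧ i < f (n + 1) := by
  refine ⟨Nat.findGreatest (fun n => f n ≤ i) i, ?_, ?_⟩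
  · exact Nat.findGreatest_spec (P := fun n => f n ≤ i) i.zero_le (by simp [h0])
  · by_contra! h
    have := Nat.le_findGreatest (P := fun n => f n ≤ i) ((hf.le_apply).trans h) h
    omega

lemma block_index_le {f : ℕ → ℕ} (hf : StrictMono f) {i m n : ℕ} (h₁ : f m ≤ i)
    (h₂ : i < f (n + 1)) : m ≤ n :=
  Nat.lt_succ_iff.1 (hf.lt_iff_lt.1 (h₁.trans_lt h₂))

lemma exists_glue {α : Type*} {f : ℕ → ℕ} (hf : StrictMono f) (h0 : f 0 = 0) (u : ℕ → ℕ → α) :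
    ∃ z : ℕ → α, ∀ n i, f n ≤ i → i < f (n + 1) → z i = u n i := by
  choose N hN₁ hN₂ using exists_mem_block hf h0
  refine ⟨fun i => u (N i) i, fun n i h₁ h₂ => ?_⟩
  simp only [le_antisymm (block_index_le hf (hN₁ i) h₂) (block_index_le hf h₁ (hN₂ i))]

lemma exists_agreeOn_blocks {f : ℕ → ℕ} (hf : StrictMono f) (h0 : f 0 = 0)
    (t : ℕ → Cantor × Cantor) : ∃ z, ∀ n, AgreeOn (f n) (f (n + 1)) z (t n) := by
  obtain ⟨z, hz⟩ := exists_glue hf h0 fun n i => ((t n).1 i, (t n).2 i)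
  refine ⟨(fun i => (z i).1, fun i => (z i).2), fun n i h₁ h₂ => ?_⟩
  simp [hz n i h₁ h₂]

lemma exists_finite_prefixes (a : ℕ) :
    ∃ H : Set (Cantor × Cantor), H.Finite ∧ ∀ p, ∃ h ∈ H, AgreeOn 0 a p h ∧
      ∀ i, a ≤ i → h.1 i = 0 ∧ h.2 i = 0 := by
  let e : (Fin a → ZMod 2) × (Fin a → ZMod 2) → Cantor × Cantor := fun s =>
    (fun i => if h : i < a then s.1 ⟨i, h⟩ else 0, fun i => if h : i < a then s.2 ⟨i, h⟩ else 0)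
  refine ⟨range e, finite_range e, fun p =>
    ⟨e (fun i => p.1 i, fun i => p.2 i), mem_range_self _, fun i _ hi => ?_, fun i hi => ?_⟩⟩
  · simp [e, hi]
  · simp [e, not_lt.2 hi]

lemma exists_pattern {U : Set (Cantor × Cantor)} (hU : IsOpen U) (hd : Dense U) (a : ℕ) :
    ∃ b > a, ∃ t, ∀ w, AgreeOn a b w t → w ∈ U := by
  obtain ⟨H, hH, hHp⟩ := exists_finite_prefixes a
  have hopen (h : Cantor × Cantor) : IsOpen ((fun v => h + v) ⁻¹' U) :=
    hU.preimage (continuous_const_add h)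
  have hdense : Dense (⋂ h ∈ H, (fun v => h + v) ⁻¹' U) :=
    dense_biInter_of_isOpen (fun h _ => hopen h) hH.countable fun h _ =>
      hd.preimage (Homeomorph.addLeft h).isOpenMap
  obtain ⟨v, hv⟩ := hdense.nonempty
  obtain ⟨b, hb⟩ := exists_agreeOn_subset (hH.isOpen_biInter fun h _ => hopen h) hv
  refine ⟨max b (a + 1), by omega, v, fun w hw => ?_⟩
  obtain ⟨h, hh, hag, hz⟩ := hHp (w - v)
  have hmem := hb (w - h) fun i _ hi => by
    rcases lt_or_ge i a with hia | hia
    · have := hag i i.zero_le hia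
      simp only [Prod.fst_sub, Prod.snd_sub, Pi.sub_apply] at this ⊢
      exact ⟨by rw [← this.1]; ring, by rw [← this.2]; ring⟩
    · have h₁ := hz i hia
      have h₂ := hw i hia (by omega)
      simp [h₁, h₂]
  simpa using mem_iInter₂.1 hmem h hh

lemma IsMeagre.exists_forall_eventually_not_agreeOn {M : Set (Cantor × Cantor)}
    (hM : IsMeagre M) : ∃ f : ℕ → ℕ, StrictMono f ∧ f 0 = 0 ∧ ∃ z, ∀ w ∈ M,
      ∀ᶠ n in atTop, ¬ AgreeOn (f n) (f (n + 1)) w z := by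
  obtain ⟨S, hSo, hSd, hSc, hS⟩ := mem_residual_iff.1 hM
  obtain ⟨V, hV⟩ := (hSc.insert univ).exists_eq_range (insert_nonempty _ _)
  have hVmem (n : ℕ) : V n = univ ∨ V n ∈ S := by
    have : V n ∈ insert univ S := hV ▸ mem_range_self n
    simpa using this
  have hVo (n : ℕ) : IsOpen (V n) := (hVmem n).elim (fun h => h ▸ isOpen_univ) (hSo _)
  have hVd (n : ℕ) : Dense (V n) := (hVmem n).elim (fun h => h ▸ dense_univ) (hSd _)
  have step (n a : ℕ) : ∃ b > a, ∃ t, ∀ w, AgreeOn a b w t → w ∈ ⋂ m ∈ Iic n, V m :=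
    exists_pattern ((finite_Iic n).isOpen_biInter fun m _ => hVo m)
      (dense_biInter_of_isOpen (fun m _ => hVo m) (finite_Iic n).countable fun m _ => hVd m) a
  choose B hB T hT using step
  let f : ℕ → ℕ := fun n => Nat.rec 0 (fun n a => B n a) n
  have hf : StrictMono f := strictMono_nat_of_lt_succ fun n => hB n (f n)
  obtain ⟨z, hz⟩ := exists_agreeOn_blocks hf rfl fun n => T n (f n)
  refine ⟨f, hf, rfl, z, fun w hw => ?_⟩
  by_contra hcon
  have hfreq : ∃ᶠ n in atTop, AgreeOn (f n) (f (n + 1)) w z := by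
    simpa [Filter.Frequently] using hcon
  refine hS (mem_sInter.2 fun t ht => ?_) hw
  obtain ⟨m, rfl⟩ : t ∈ range V := hV ▸ mem_insert_of_mem _ ht
  obtain ⟨n, hmn, hn⟩ := (frequently_atTop.1 hfreq) m
  exact mem_iInter₂.1 (hT n (f n) w (hn.trans (hz n))) m hmn

lemma isMeagre_setOf_eventually_not_agreeOn {f : ℕ → ℕ} (hf : StrictMono f)
    (z : Cantor × Cantor) :
    IsMeagre {w | ∀ᶠ n in atTop, ¬ AgreeOn (f n) (f (n + 1)) w z} := by
  have hres (m : ℕ) : (⋃ n ∈ Ici m, {w | AgreeOn (f n) (f (n + 1)) w z}) ∈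
      residual (Cantor × Cantor) := by
    refine residual_of_dense_open
      (isOpen_biUnion fun n _ => isOpen_setOf_agreeOn _ _ z) (dense_iff_inter_open.2 ?_)
    rintro V hV ⟨v, hv⟩
    obtain ⟨b, hb⟩ := exists_agreeOn_subset hV hv
    have hle : max m b ≤ f (max m b) := hf.le_apply
    refine ⟨(fun i => if i < b then v.1 i else z.1 i, fun i => if i < b then v.2 i else z.2 i),
      hb _ fun i _ hi => by simp [hi],
      mem_biUnion (mem_Ici.2 (le_max_left m b)) fun i hi _ => ?_⟩
    have : ¬ i < b := by omega
    simp [this]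
  refine mem_of_superset (countable_iInter_mem.2 hres) fun w hw hev => ?_
  obtain ⟨m, hm⟩ := eventually_atTop.1 hev
  obtain ⟨n, hn, hag⟩ := mem_iUnion₂.1 (mem_iInter.1 hw m)
  exact hm n hn hag

lemma IsSSMZ.isMeagre_add {X M : Set (Cantor × Cantor)} (hX : IsSSMZ X) (hM : IsMeagre M) :
    IsMeagre (X + M) := by
  obtain ⟨f, hf, h0, z, hz⟩ := hM.exists_forall_eventually_not_agreeOn
  obtain ⟨U, ⟨k, hk0, hk, hcov⟩, hU⟩ := hX (fun n => (1 / 2) ^ f (n + 1)) fun n => by positivity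
  have hpt (n : ℕ) : ∃ s, ∀ p ∈ U n, AgreeOn 0 (f (n + 1)) p s := by
    rcases (U n).eq_empty_or_nonempty with h | ⟨s, hs⟩
    · exact ⟨0, by simp [h]⟩
    · refine ⟨s, fun p hp => agreeOn_zero_iff_dist_le.2 ?_⟩
      have := (Metric.edist_le_ediam_of_mem hp hs).trans (hU n)
      rwa [edist_dist, ENNReal.ofReal_le_ofReal_iff (by positivity)] at this
  choose s hs using hpt
  obtain ⟨y, hy⟩ := exists_agreeOn_blocks hf h0 s
  refine (isMeagre_setOf_eventually_not_agreeOn (hf.comp hk) (y + z)).mono ?_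
  rintro _ ⟨x, hx, w, hw, rfl⟩
  filter_upwards [hcov x hx, hk.tendsto_atTop.eventually (eventually_forall_ge_atTop.2 (hz w hw))]
    with j hj hne hag
  obtain ⟨n, hn₁, hn₂, hxn⟩ := hj
  refine hne n hn₁ fun i h₁ h₂ => ?_
  have e₁ := hag i ((hf.monotone hn₁).trans h₁) (h₂.trans_le (hf.monotone hn₂))
  have e₂ := hs n x hxn i i.zero_le h₂
  have e₃ := hy n i h₁ h₂
  simpa [e₂, e₃] using e₁

lemma exists_agreeOn_blocks_of_isMeagre_add {X : Set (Cantor × Cantor)}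
    (hX : ∀ M : Set (Cantor × Cantor), IsMeagre M → IsMeagre (X + M))
    {f : ℕ → ℕ} (hf : StrictMono f) (h0 : f 0 = 0) :
    ∃ k : ℕ → ℕ, k 0 = 0 ∧ StrictMono k ∧ ∃ z, ∀ x ∈ X, ∀ᶠ j in atTop,
      ∃ n, k j ≤ n ∧ n < k (j + 1) ∧ AgreeOn (f n) (f (n + 1)) x z := by
  obtain ⟨g, hg, -, z, hz⟩ :=
    (hX _ (isMeagre_setOf_eventually_not_agreeOn hf 0)).exists_forall_eventually_not_agreeOn
  let k : ℕ → ℕ := fun j => Nat.rec 0 (fun _ a => g (f a + 1)) j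
  have hksucc (j : ℕ) : k (j + 1) = g (f (k j) + 1) := rfl
  have hk : StrictMono k := strictMono_nat_of_lt_succ fun j => by
    have h₁ : f (k j) + 1 ≤ g (f (k j) + 1) := hg.le_apply
    have h₂ : k j ≤ f (k j) := hf.le_apply
    rw [hksucc]
    omega
  refine ⟨k, rfl, hk, z, fun x hx => ?_⟩
  classical
  obtain ⟨w, hw⟩ := exists_agreeOn_blocks hf h0 fun n =>
    if AgreeOn (f n) (f (n + 1)) x z then 1 else z - x
  have hwM : ∀ n, ¬ AgreeOn (f n) (f (n + 1)) w 0 := by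
    intro n hn
    have hn' := (hw n).symm.trans hn
    split_ifs at hn' with hxz
    · have := (hn' (f n) le_rfl (hf n.lt_succ_self)).1
      simp at this
    · refine hxz fun i h₁ h₂ => ?_
      have := hn' i h₁ h₂
      simp only [Prod.fst_sub, Prod.snd_sub, Pi.sub_apply, Prod.fst_zero, Prod.snd_zero,
        Pi.zero_apply, sub_eq_zero] at this
      exact ⟨this.1.symm, this.2.symm⟩
  have hev := hz (x + w) (add_mem_add hx (Eventually.of_forall hwM))
  filter_upwards [(hf.comp hk).tendsto_atTop.eventually hev] with j hj
  by_contra! hcon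
  refine hj fun i h₁ h₂ => ?_
  obtain ⟨n, hn₁, hn₂⟩ := exists_mem_block hf h0 i
  have hgi : f (k j) ≤ i := le_trans (hg.le_apply (x := f (k j))) h₁
  have hik : i < f (k (j + 1)) := lt_of_lt_of_le h₂ (hf.le_apply (x := k (j + 1)))
  have hkn : k j ≤ n := block_index_le hf hgi hn₂
  have hnk : n < k (j + 1) := hf.lt_iff_lt.1 (hn₁.trans_lt hik)
  have := hw n i hn₁ hn₂
  rw [if_neg (hcon n hkn hnk)] at this
  simp [this]

lemma exists_prefix_enumeration (a : ℕ) :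
    ∃ (c : ℕ) (e : ℕ → Cantor × Cantor), ∀ p, ∃ i < c, AgreeOn 0 a p (e i) := by
  obtain ⟨H, hH, hHp⟩ := exists_finite_prefixes a
  have := hH.to_subtype
  have : Nonempty H := let ⟨h, hh, _⟩ := hHp 0; ⟨h, hh⟩
  obtain ⟨u, hu⟩ := exists_surjective_nat H
  choose g hg using hu
  obtain ⟨c, hc⟩ := Finite.exists_le g
  refine ⟨c + 1, fun i => u i, fun p => ?_⟩
  obtain ⟨h, hh, hag, -⟩ := hHp p
  exact ⟨g ⟨h, hh⟩, Nat.lt_succ_iff.2 (hc _), by simpa [hg] using hag⟩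

lemma exists_pow_le_of_pos {ε : ℕ → ℝ} (hε : ∀ n, 0 < ε n) (N : ℕ) :
    ∃ b, ∀ b' ≥ b, ∀ m < N, (1 / 2 : ℝ) ^ b' ≤ ε m := by
  have : ∀ᶠ b in atTop, ∀ m ∈ Iio N, (1 / 2 : ℝ) ^ b ≤ ε m :=
    (finite_Iio N).eventually_all.2 fun m _ =>
      ((tendsto_pow_atTop_nhds_zero_of_lt_one (by norm_num) (by norm_num)).eventually_le_const
        (hε m))
  exact eventually_atTop.1 this

lemma isSSMZ_of_isMeagre_add {X : Set (Cantor × Cantor)}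
    (hX : ∀ M : Set (Cantor × Cantor), IsMeagre M → IsMeagre (X + M)) : IsSSMZ X := by
  intro ε hε
  choose c e he using exists_prefix_enumeration
  have hc (a : ℕ) : 0 < c a := let ⟨_, hi, _⟩ := he a 0; by omega
  choose b hb using exists_pow_le_of_pos hε
  let F : ℕ → ℕ × ℕ := fun n =>
    Nat.rec (0, 0) (fun _ q => (max (q.1 + 1) (b (q.2 + c q.1)), q.2 + c q.1)) n
  let f : ℕ → ℕ := fun n => (F n).1
  let N : ℕ → ℕ := fun n => (F n).2
  have hNsucc (n : ℕ) : N (n + 1) = N n + c (f n) := rfl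
  have hfsucc (n : ℕ) : f (n + 1) = max (f n + 1) (b (N (n + 1))) := rfl
  have hf : StrictMono f := strictMono_nat_of_lt_succ fun n => by rw [hfsucc]; omega
  have hN : StrictMono N := strictMono_nat_of_lt_succ fun n => by
    have := hc (f n)
    rw [hNsucc]
    omega
  obtain ⟨k, hk0, hk, z, hz⟩ := exists_agreeOn_blocks_of_isMeagre_add hX hf rfl
  obtain ⟨U, hU⟩ := exists_glue hN rfl fun n m =>
    {p | AgreeOn 0 (f n) p (e (f n) (m - N n)) ∧ AgreeOn (f n) (f (n + 1)) p z}
  refine ⟨U, ⟨fun j => N (k j), by simp [hk0, N, F], hN.comp hk, fun x hx => ?_⟩, fun m => ?_⟩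
  · filter_upwards [hz x hx] with j ⟨n, hn₁, hn₂, hag⟩
    obtain ⟨i, hi, hxi⟩ := he (f n) x
    have h₁ : N (k j) ≤ N n := hN.monotone hn₁
    have h₂ : N (n + 1) ≤ N (k (j + 1)) := hN.monotone hn₂
    have h₃ : N n + i < N (n + 1) := by rw [hNsucc]; omega
    refine ⟨N n + i, by omega, by omega, ?_⟩
    rw [hU n _ (Nat.le_add_right _ _) h₃]
    exact ⟨by simpa using hxi, hag⟩
  · obtain ⟨n, hn₁, hn₂⟩ := exists_mem_block hN rfl m
    rw [hU n m hn₁ hn₂]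
    refine Metric.ediam_le fun p hp q hq => ?_
    rw [edist_dist]
    refine ENNReal.ofReal_le_ofReal ((agreeOn_zero_iff_dist_le.1
      ((hp.1.trans hq.1.symm).append (hp.2.trans hq.2.symm))).trans
      (hb (N (n + 1)) _ ?_ m hn₂))
    rw [hfsucc]
    exact le_max_right _ _

/-- A set `X ⊆ 2^ℕ × 2^ℕ` is meager-additive in the product group iff it has sharp measure
zero with respect to the maximum metric. -/
theorem stmt14 (X : Set (Cantor × Cantor)) :
    (∀ M : Set (Cantor × Cantor), IsMeagre M → IsMeagre (X + M)) ↔ IsSSMZ X := by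
  exact ⟨isSSMZ_of_isMeagre_add, fun hX _ hM => hX.isMeagre_add hM⟩
end

section
/- Let T : 2^ℕ → [0,1] be the map T(x) = ∑_{n∈ℕ} 2^{-n-1} x(n). A set X ⊆ [0,1] has sharp measure zero (with respect to the Euclidean metric) if and only if T^{-1}(X) ⊆ 2^ℕ has sharp measure zero (with respect to the least-difference metric). -/
open MeasureTheory Set Filter Pointwise
open scoped ENNReal NNReal Topology

/-- The standard map `T : 2^ℕ → [0,1]`, `T x = ∑ₙ 2^{-n-1} x(n)`. -/
noncomputable def T (x : Cantor) : ℝ := ∑' n : ℕ, ((2 : ℝ) ^ (n + 1))⁻¹ * ((x n).val : ℝ)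

lemma T_eq_ofDigits (x : Cantor) : T x = Real.ofDigits (b := 2) x := by
  unfold T Real.ofDigits
  refine tsum_congr fun n => ?_
  simp only [Real.ofDigitsTerm, Nat.cast_ofNat]
  exact mul_comm _ _

lemma exists_T_eq {t : ℝ} (ht : t ∈ Set.Icc (0 : ℝ) 1) : ∃ x : Cantor, T x = t := by
  obtain ⟨x, -, hx⟩ := Real.ofDigits_SurjOn one_lt_two ht
  exact ⟨x, (T_eq_ofDigits x).trans hx⟩

lemma Cantor.dist_le_iff {x y : Cantor} {n : ℕ} :
    dist x y ≤ (1 / 2 : ℝ) ^ n ↔ ∀ i < n, x i = y i :=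
  PiNat.mem_cylinder_iff_dist_le.symm

lemma lipschitzWith_T : LipschitzWith 1 T := by
  refine LipschitzWith.of_dist_le_mul fun x y => ?_
  rw [NNReal.coe_one, one_mul]
  refine PiNat.lipschitz_with_one_iff_forall_dist_image_le_of_mem_cylinder.2
    (fun x y n h => ?_) x y
  rw [Real.dist_eq, T_eq_ofDigits, T_eq_ofDigits, one_div, inv_pow]
  simpa using Real.abs_ofDigits_sub_ofDigits_le (b := 2) (fun i hi => (h i hi).symm)

/-- The natural number whose binary expansion is given by the first `k` digits of `x`. -/
def binaryValue (x : Cantor) : ℕ → ℕ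
  | 0 => 0
  | k + 1 => 2 * binaryValue x k + (x k).val

lemma eq_of_binaryValue_eq {x y : Cantor} {k : ℕ} (h : binaryValue x k = binaryValue y k) :
    ∀ i < k, x i = y i := by
  induction k with
  | zero => intro i hi; omega
  | succ k ih =>
    have hx := ZMod.val_lt (x k)
    have hy := ZMod.val_lt (y k)
    simp only [binaryValue] at h
    intro i hi
    rcases Nat.lt_succ_iff_lt_or_eq.1 hi with hi | rfl
    · exact ih (by omega) i hi
    · exact ZMod.val_injective 2 (by omega)

lemma two_pow_mul_sum_ofDigitsTerm (x : Cantor) (k : ℕ) :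
    (2 : ℝ) ^ k * ∑ i ∈ Finset.range k, Real.ofDigitsTerm (b := 2) x i = binaryValue x k := by
  induction k with
  | zero => simp [binaryValue]
  | succ k ih =>
    have hx : ((x k).val : ℝ) = ((Fin.val (n := 2) (x k) : ℕ) : ℝ) := rfl
    rw [Finset.sum_range_succ, mul_add, pow_succ', mul_assoc, ih, binaryValue]
    simp only [Real.ofDigitsTerm]
    push_cast
    rw [hx, pow_succ]
    field_simp

lemma two_pow_mul_T_mem_Icc (x : Cantor) (k : ℕ) :
    (2 : ℝ) ^ k * T x ∈ Set.Icc (binaryValue x k : ℝ) (binaryValue x k + 1) := by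
  have h0 := Real.ofDigits_nonneg (b := 2) fun i => x (i + k)
  have h1 := Real.ofDigits_le_one (b := 2) fun i => x (i + k)
  have h : (2 : ℝ) ^ k * T x =
      binaryValue x k + Real.ofDigits (b := 2) fun i => x (i + k) := by
    rw [T_eq_ofDigits, Real.ofDigits_eq_sum_add_ofDigits (b := 2) x k, mul_add,
      ← two_pow_mul_sum_ofDigitsTerm, Nat.cast_ofNat, mul_inv_cancel_left₀ (by positivity)]
  rw [h]
  constructor <;> linarith

lemma binaryValue_le_succ_of_dist_le {x y : Cantor} {k : ℕ}
    (h : dist (T x) (T y) ≤ (1 / 2) ^ (k + 1)) : binaryValue x k ≤ binaryValue y k + 1 := by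
  have hx := (two_pow_mul_T_mem_Icc x k).1
  have hy := (two_pow_mul_T_mem_Icc y k).2
  have hxy : (2 : ℝ) ^ k * (T x - T y) ≤ 1 / 2 := by
    calc (2 : ℝ) ^ k * (T x - T y) ≤ 2 ^ k * (1 / 2) ^ (k + 1) := by
          gcongr
          exact (le_abs_self _).trans h
      _ = 1 / 2 := by rw [pow_succ, ← mul_assoc, ← mul_pow]; norm_num
  have : (binaryValue x k : ℝ) < binaryValue y k + 2 := by linarith
  have : binaryValue x k < binaryValue y k + 2 := by exact_mod_cast this
  omega

/-- The preimage under `T` of a sufficiently small set is covered by three small sets. -/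
lemma exists_preimage_T_cover {ε : ℝ} (hε : 0 < ε) :
    ∃ δ : ℝ, 0 < δ ∧ ∀ U : Set ℝ, Metric.ediam U ≤ ENNReal.ofReal δ →
      ∃ V : ℕ → Set Cantor, (∀ i, Metric.ediam (V i) ≤ ENNReal.ofReal ε) ∧
        ∀ x, T x ∈ U → ∃ i < 3, x ∈ V i := by
  obtain ⟨k, hk⟩ := exists_pow_lt_of_lt_one hε (by norm_num : (1 / 2 : ℝ) < 1)
  refine ⟨(1 / 2) ^ (k + 1), by positivity, fun U hU => ?_⟩
  rcases (T ⁻¹' U).eq_empty_or_nonempty with hempty | ⟨x₀, hx₀⟩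
  · refine ⟨fun _ => ∅, fun i => Metric.ediam_le (by simp), fun x hx => ?_⟩
    exact absurd (show x ∈ T ⁻¹' U from hx) (by simp [hempty])
  · have hdist : ∀ x y, T x ∈ U → T y ∈ U → dist (T x) (T y) ≤ (1 / 2) ^ (k + 1) := by
      intro x y hx hy
      have := Metric.edist_le_of_ediam_le hx hy hU
      rwa [edist_dist, ENNReal.ofReal_le_ofReal_iff (by positivity)] at this
    refine ⟨fun i => {x | binaryValue x k + 1 = binaryValue x₀ k + i}, fun i => ?_,
      fun x hx => ?_⟩
    · refine Metric.ediam_le fun x hx y hy => ?_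
      rw [edist_dist]
      refine ENNReal.ofReal_le_ofReal (le_trans (Cantor.dist_le_iff.2 ?_) hk.le)
      simp only [Set.mem_ofPred_eq] at hx hy
      exact eq_of_binaryValue_eq (by omega)
    · have h1 := binaryValue_le_succ_of_dist_le (hdist x x₀ hx hx₀)
      have h2 := binaryValue_le_succ_of_dist_le (hdist x₀ x hx₀ hx)
      refine ⟨binaryValue x k + 1 - binaryValue x₀ k, by omega, ?_⟩
      change binaryValue x k + 1 = _
      omega

lemma IsSSMZ.preimage_T {X : Set ℝ} (h : IsSSMZ X) : IsSSMZ (T ⁻¹' X) := by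
  intro ε hε
  have hmin : ∀ n, 0 < min (ε (3 * n)) (min (ε (3 * n + 1)) (ε (3 * n + 2))) := fun n =>
    lt_min (hε _) (lt_min (hε _) (hε _))
  choose δ hδ hcover using fun n => exists_preimage_T_cover (hmin n)
  obtain ⟨U, ⟨k, hk0, hk, hU⟩, hdiam⟩ := h δ hδ
  choose V hV hUV using fun n => hcover n (U n) (hdiam n)
  refine ⟨fun m => V (m / 3) (m % 3), ⟨fun j => 3 * k j, by simp [hk0],
    fun i j hij => Nat.mul_lt_mul_of_pos_left (hk hij) (by norm_num), fun x hx => ?_⟩,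
    fun m => (hV _ _).trans (ENNReal.ofReal_le_ofReal ?_)⟩
  · filter_upwards [hU (T x) hx] with j ⟨n, hn, hn', hxn⟩
    obtain ⟨i, hi, hxi⟩ := hUV n x hxn
    refine ⟨3 * n + i, by omega, by omega, ?_⟩
    rwa [show (3 * n + i) / 3 = n by omega, show (3 * n + i) % 3 = i by omega]
  · have hm : m = 3 * (m / 3) ∨ m = 3 * (m / 3) + 1 ∨ m = 3 * (m / 3) + 2 := by omega
    rcases hm with hm | hm | hm
    · exact (min_le_left _ _).trans_eq (congrArg ε hm.symm)
    · exact ((min_le_right _ _).trans (min_le_left _ _)).trans_eq (congrArg ε hm.symm)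
    · exact ((min_le_right _ _).trans (min_le_right _ _)).trans_eq (congrArg ε hm.symm)

/-- Sharp measure zero is preserved by `1`-Lipschitz images. -/
lemma IsSSMZ.image {X Y : Type*} [MetricSpace X] [MetricSpace Y] {f : X → Y}
    (hf : LipschitzWith 1 f) {E : Set X} (h : IsSSMZ E) : IsSSMZ (f '' E) := by
  intro ε hε
  obtain ⟨U, ⟨k, hk0, hk, hU⟩, hdiam⟩ := h ε hε
  refine ⟨fun n => f '' U n, ⟨k, hk0, hk, ?_⟩, fun n => ?_⟩
  · rintro _ ⟨x, hx, rfl⟩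
    filter_upwards [hU x hx] with j ⟨n, hn, hn', hxn⟩
    exact ⟨n, hn, hn', x, hxn, rfl⟩
  · refine (hf.ediam_image_le (U n)).trans ?_
    rw [ENNReal.coe_one, one_mul]
    exact hdiam n

/-- `X ⊆ [0,1]` has sharp measure zero (Euclidean metric) iff `T ⁻¹' X` has sharp measure
zero (least-difference metric on `2^ℕ`). -/
theorem stmt16 (X : Set ℝ) (hX : X ⊆ Set.Icc 0 1) :
    IsSSMZ X ↔ IsSSMZ (T ⁻¹' X) := by
  refine ⟨IsSSMZ.preimage_T, fun h => ?_⟩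
  have hrange : X ⊆ Set.range T := fun t ht => exists_T_eq (hX ht)
  simpa only [Set.image_preimage_eq_of_subset hrange] using h.image lipschitzWith_T
end

section
/- Every γ-set (a separable metric space X such that every ω-cover of X contains a countable subfamily that is a γ-cover of X) has sharp measure zero. -/
open MeasureTheory Set Filter Pointwise
open scoped ENNReal NNReal Topology

theorem hasSSMZ_of_finite (X : Type*) [MetricSpace X] [Finite X] : HasSSMZ X := by
  intro ε _
  obtain ⟨N, ⟨e⟩⟩ := Finite.exists_equiv_fin X
  refine ⟨fun n ↦ {x | (e x : ℕ) = n % (N + 1)}, ⟨fun j ↦ j * (N + 1), by simp, ?_, ?_⟩, ?_⟩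
  · exact fun a b h ↦ Nat.mul_lt_mul_of_pos_right h N.succ_pos
  · refine fun x _ ↦ Eventually.of_forall fun j ↦ ⟨j * (N + 1) + e x, by simp, ?_, ?_⟩
    · have := (e x).isLt
      simp only [add_mul]
      omega
    · have := (e x).isLt
      simp only [mem_ofPred_eq, Nat.mul_add_mod_self_right]
      exact (Nat.mod_eq_of_lt (by omega)).symm
  · intro n
    have h : ({x | (e x : ℕ) = n % (N + 1)} : Set X).Subsingleton := fun x hx y hy ↦
      e.injective (Fin.ext (Eq.trans hx (Eq.symm hy)))
    exact (Metric.ediam_subsingleton h).trans_le zero_le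

/-- The union of balls `ball (c i) (r i)` for `m ≤ i < 2 * m`, with the point `a m` removed. -/
def puncturedBallUnion {X : Type*} [MetricSpace X] (r : ℕ → ℝ) (a : ℕ → X) (m : ℕ) (c : ℕ → X) :
    Set X :=
  (⋃ i ∈ Ico m (2 * m), Metric.ball (c i) (r i)) \ {a m}

theorem isOpen_puncturedBallUnion {X : Type*} [MetricSpace X] (r : ℕ → ℝ) (a : ℕ → X) (m : ℕ)
    (c : ℕ → X) : IsOpen (puncturedBallUnion r a m c) :=
  (isOpen_biUnion fun _ _ ↦ Metric.isOpen_ball).sdiff isClosed_singleton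

theorem exists_finset_subset_puncturedBallUnion {X : Type*} [MetricSpace X] {r : ℕ → ℝ}
    (hr : ∀ n, 0 < r n) {a : ℕ → X} (ha : Function.Injective a) (F : Finset X) :
    ∃ m c, (F : Set X) ⊆ puncturedBallUnion r a m c := by
  obtain ⟨m, hm⟩ := ((F.finite_toSet.preimage ha.injOn).union (finite_Iio F.card)).exists_notMem
  simp only [mem_union, mem_preimage, SetLike.mem_coe, mem_Iio, not_or, not_lt] at hm
  refine ⟨m, fun i ↦ if h : i - m < F.card then (F.equivFin.symm ⟨i - m, h⟩ : X) else a 0,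
    fun x hx ↦ ⟨?_, ?_⟩⟩
  · have hlt := (F.equivFin ⟨x, hx⟩).isLt
    refine mem_biUnion (x := m + F.equivFin ⟨x, hx⟩) ⟨by omega, by omega⟩ ?_
    simp [hr]
  · rintro rfl
    exact hm.1 hx

/-- Sets of prescribed diameters indexed by consecutive blocks can be glued into one sequence. -/
theorem exists_glue_blocks {X : Type*} [MetricSpace X] {ε : ℕ → ℝ} {k : ℕ → ℕ} (hk : StrictMono k)
    (B : ℕ → ℕ → Set X) (hB : ∀ j i, Metric.ediam (B j i) ≤ ENNReal.ofReal (ε i)) :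
    ∃ W : ℕ → Set X, (∀ i, Metric.ediam (W i) ≤ ENNReal.ofReal (ε i)) ∧
      ∀ j i, k j ≤ i → i < k (j + 1) → B j i ⊆ W i := by
  have key (i : ℕ) : ∃ W : Set X, Metric.ediam W ≤ ENNReal.ofReal (ε i) ∧
      ∀ j, k j ≤ i → i < k (j + 1) → B j i ⊆ W := by
    by_cases h : ∃ j, k j ≤ i ∧ i < k (j + 1)
    · obtain ⟨j, h₁, h₂⟩ := h
      refine ⟨B j i, hB j i, fun l h₃ h₄ ↦ ?_⟩
      have h₅ := hk.lt_iff_lt.1 (h₁.trans_lt h₄)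
      have h₆ := hk.lt_iff_lt.1 (h₃.trans_lt h₂)
      obtain rfl : l = j := by omega
      exact Subset.rfl
    · exact ⟨∅, Metric.ediam_empty.trans_le zero_le, fun j h₁ h₂ ↦ absurd ⟨j, h₁, h₂⟩ h⟩
  choose W h₁ h₂ using key
  exact ⟨W, h₁, fun j i ↦ h₂ i j⟩

/-- Every γ-set (a separable metric space in which every ω-cover contains a countable
subfamily that is a γ-cover) has sharp measure zero. -/
theorem stmt17 (X : Type) [MetricSpace X] [TopologicalSpace.SeparableSpace X]
    (hX : ∀ 𝒰 : Set (Set X), (∀ U ∈ 𝒰, IsOpen U) →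
        (∀ F : Finset X, ∃ U ∈ 𝒰, (F : Set X) ⊆ U) →
        ∃ U : ℕ → Set X, (∀ n, U n ∈ 𝒰) ∧ ∀ x : X, ∀ᶠ n in Filter.atTop, x ∈ U n) :
    HasSSMZ X := by
  obtain _ | _ := finite_or_infinite X
  · exact hasSSMZ_of_finite X
  intro ε hε
  have hr (n : ℕ) : 0 < ε n / 2 := half_pos (hε n)
  let a := Infinite.natEmbedding X
  obtain ⟨U, hU, hγ⟩ := hX {V | ∃ m c, V = puncturedBallUnion (fun n ↦ ε n / 2) a m c}
    (by rintro _ ⟨m, c, rfl⟩; exact isOpen_puncturedBallUnion _ _ _ _)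
    (fun F ↦ by
      obtain ⟨m, c, h⟩ := exists_finset_subset_puncturedBallUnion hr a.injective F
      exact ⟨_, ⟨m, c, rfl⟩, h⟩)
  choose m c hU using hU
  have hm : Tendsto m atTop atTop := by
    refine tendsto_atTop.2 fun M ↦ ?_
    have h : ∀ᶠ n in atTop, ∀ i ∈ Iio M, a i ∈ U n :=
      (eventually_all_finite (finite_Iio M)).2 fun i _ ↦ hγ (a i)
    filter_upwards [h] with n hn
    by_contra! hlt
    have := hn (m n) hlt
    rw [hU n] at this
    exact this.2 rfl
  have hstep (s : ℕ) : ∃ n, s < n ∧ 2 * m s + 1 ≤ m n :=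
    ((eventually_gt_atTop s).and (hm.eventually_ge_atTop _)).exists
  choose g hg hmg using hstep
  let φ : ℕ → ℕ := fun j ↦ g^[j] 0
  have hsucc (j : ℕ) : φ (j + 1) = g (φ j) := Function.iterate_succ_apply' g j 0
  have hφ : StrictMono φ := strictMono_nat_of_lt_succ fun j ↦ hsucc j ▸ hg (φ j)
  have hmφ (j : ℕ) : 2 * m (φ j) + 1 ≤ m (φ (j + 1)) := hsucc j ▸ hmg (φ j)
  let k : ℕ → ℕ := fun j ↦ if j = 0 then 0 else m (φ j)
  have hkm (j : ℕ) : k j ≤ m (φ j) := by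
    dsimp only [k]
    split_ifs <;> omega
  have hks (j : ℕ) : k (j + 1) = m (φ (j + 1)) := if_neg j.succ_ne_zero
  have hk : StrictMono k := strictMono_nat_of_lt_succ fun j ↦ by
    have := hkm j
    have := hks j
    have := hmφ j
    omega
  obtain ⟨W, hW, hBW⟩ := exists_glue_blocks (ε := ε) hk
    (fun j i ↦ Metric.ball (c (φ j) i) (ε i / 2)) fun j i ↦ by
      rw [← Metric.eball_ofReal]
      refine Metric.ediam_eball_le.trans_eq ?_
      rw [← ENNReal.ofReal_ofNat 2, ← ENNReal.ofReal_mul (by norm_num)]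
      congr 1
      ring
  refine ⟨W, ⟨k, rfl, hk, fun x _ ↦ ?_⟩, hW⟩
  filter_upwards [hφ.tendsto_atTop.eventually (hγ x)] with j hj
  rw [hU] at hj
  obtain ⟨i, hi, hx⟩ := mem_iUnion₂.1 hj.1
  have h₁ : k j ≤ i := (hkm j).trans hi.1
  have h₂ : i < k (j + 1) := by
    have := hi.2
    have := hks j
    have := hmφ j
    omega
  exact ⟨i, h₁, h₂, hBW j i h₁ h₂ hx⟩
end

section
/- Every set with sharp measure zero is universally meager: if X and Y are nonempty perfect Polish spaces, E ⊆ X has sharp measure zero (with respect to a complete metric inducing the topology of X), and f : Y → X is a continuous injective map, then f^{-1}(E) is meager in Y. -/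
open MeasureTheory Set Filter Pointwise
open scoped ENNReal NNReal Topology

/-- In a perfect space, the image of a nonempty open set under a continuous injection contains the
images of two nonempty open subsets at positive distance from each other. -/
theorem exists_open_subsets_separated {X Y : Type*} [MetricSpace X] [TopologicalSpace Y]
    (hY : Perfect (Set.univ : Set Y)) {f : Y → X} (hf : Continuous f)
    (hinj : Function.Injective f) {V : Set Y} (hV : IsOpen V) (hne : V.Nonempty) :
    ∃ V₀ V₁ : Set Y, ∃ δ : ℝ, 0 < δ ∧ (IsOpen V₀ ∧ V₀.Nonempty) ∧ (IsOpen V₁ ∧ V₁.Nonempty) ∧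
      V₀ ⊆ V ∧ V₁ ⊆ V ∧ ∀ y₀ ∈ V₀, ∀ y₁ ∈ V₁, δ < dist (f y₀) (f y₁) := by
  obtain ⟨a, ha⟩ := hne
  obtain ⟨b, ⟨hb, -⟩, hba⟩ := accPt_iff_nhds.1 (hY.acc a (mem_univ a)) V (hV.mem_nhds ha)
  have hd : 0 < dist (f a) (f b) := dist_pos.2 fun h => hba (hinj h).symm
  have hd4 : 0 < dist (f a) (f b) / 4 := by positivity
  refine ⟨V ∩ f ⁻¹' Metric.ball (f a) (dist (f a) (f b) / 4),
    V ∩ f ⁻¹' Metric.ball (f b) (dist (f a) (f b) / 4), dist (f a) (f b) / 4, hd4,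
    ⟨hV.inter (Metric.isOpen_ball.preimage hf), a, ha, Metric.mem_ball_self hd4⟩,
    ⟨hV.inter (Metric.isOpen_ball.preimage hf), b, hb, Metric.mem_ball_self hd4⟩,
    inter_subset_left, inter_subset_left, ?_⟩
  rintro y₀ ⟨-, h₀⟩ y₁ ⟨-, h₁⟩
  have h₀ : dist (f y₀) (f a) < dist (f a) (f b) / 4 := h₀
  have h₁ : dist (f y₁) (f b) < dist (f a) (f b) / 4 := h₁
  have := dist_triangle4 (f a) (f y₀) (f y₁) (f b)
  rw [dist_comm (f a) (f y₀)] at this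
  linarith

/-- In a second countable perfect space `Y` with a continuous injection into a metric space, there
are positive reals `ε n` such that, for every nonempty open set `B`, finitely many sets `U n` with
`diam (U n) ≤ ε n` and with sufficiently large indices have preimages missing a nonempty open
subset of `B`. -/
theorem exists_pos_seq_forall_exists_open_disjoint {X Y : Type*} [MetricSpace X]
    [TopologicalSpace Y] [SecondCountableTopology Y] [Nonempty Y]
    (hY : Perfect (Set.univ : Set Y)) {f : Y → X} (hf : Continuous f)
    (hinj : Function.Injective f) :
    ∃ ε : ℕ → ℝ, (∀ n, 0 < ε n) ∧ ∀ U : ℕ → Set X,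
      (∀ n, Metric.ediam (U n) ≤ ENNReal.ofReal (ε n)) →
      ∀ B : Set Y, IsOpen B → B.Nonempty → ∃ N, ∀ p q, N ≤ p → p ≤ q →
        ∃ V : Set Y, IsOpen V ∧ V.Nonempty ∧ V ⊆ B ∧
          ∀ n, p ≤ n → n < q → ∀ y ∈ V, f y ∉ U n := by
  classical
  let O := {V : Set Y // IsOpen V ∧ V.Nonempty}
  have split (V : O) : ∃ V₀ V₁ : O, ∃ δ : ℝ, 0 < δ ∧ V₀.1 ⊆ V.1 ∧ V₁.1 ⊆ V.1 ∧
      ∀ y₀ ∈ V₀.1, ∀ y₁ ∈ V₁.1, δ < dist (f y₀) (f y₁) := by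
    obtain ⟨V₀, V₁, δ, hδ, h₀, h₁, h⟩ := exists_open_subsets_separated hY hf hinj V.2.1 V.2.2
    exact ⟨⟨V₀, h₀⟩, ⟨V₁, h₁⟩, δ, hδ, h⟩
  choose c₀ c₁ δ hδ hc₀ hc₁ hsep using split
  obtain ⟨b, hbc, hb0, hb⟩ := TopologicalSpace.exists_countable_basis Y
  obtain ⟨y⟩ := ‹Nonempty Y›
  obtain ⟨v, hv, -⟩ := hb.exists_subset_of_mem_open (mem_univ y) isOpen_univ
  obtain ⟨e, rfl⟩ := hbc.exists_eq_range ⟨v, hv⟩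
  let e' (n : ℕ) : O := ⟨e n, hb.isOpen (mem_range_self n),
    nonempty_iff_ne_empty.2 fun h => hb0 (h ▸ mem_range_self n)⟩
  let F : ℕ → Finset O := fun n =>
    n.rec ∅ fun n s => insert (e' n) (s.image c₀ ∪ s.image c₁)
  have hF (n : ℕ) : F (n + 1) = insert (e' n) ((F n).image c₀ ∪ (F n).image c₁) := rfl
  have hF₀ {n : ℕ} {V : O} (hV : V ∈ F n) : c₀ V ∈ F (n + 1) := by
    rw [hF]
    exact Finset.mem_insert_of_mem (Finset.mem_union_left _ (Finset.mem_image_of_mem _ hV))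
  have hF₁ {n : ℕ} {V : O} (hV : V ∈ F n) : c₁ V ∈ F (n + 1) := by
    rw [hF]
    exact Finset.mem_insert_of_mem (Finset.mem_union_right _ (Finset.mem_image_of_mem _ hV))
  have hε (n : ℕ) : ∃ r : ℝ, 0 < r ∧ ∀ V ∈ F n, r ≤ δ V := by
    induction F n using Finset.induction with
    | empty => exact ⟨1, one_pos, by simp⟩
    | insert V s _ ih =>
      obtain ⟨r, hr, h⟩ := ih
      refine ⟨min r (δ V), lt_min hr (hδ V), fun W hW => ?_⟩
      rcases Finset.mem_insert.1 hW with rfl | hW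
      · exact min_le_right _ _
      · exact (min_le_left _ _).trans (h W hW)
  choose ε hε hεδ using hε
  refine ⟨ε, hε, fun U hU B hB ⟨x, hx⟩ => ?_⟩
  obtain ⟨_, ⟨i, rfl⟩, -, hiB⟩ := hb.exists_subset_of_mem_open hx hB
  have avoid {n : ℕ} {V : O} (hV : V ∈ F n) :
      ∃ W ∈ F (n + 1), W.1 ⊆ V.1 ∧ ∀ y ∈ W.1, f y ∉ U n := by
    by_cases h : ∀ y ∈ (c₀ V).1, f y ∉ U n
    · exact ⟨_, hF₀ hV, hc₀ V, h⟩
    · push Not at h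
      obtain ⟨y₀, hy₀, hU₀⟩ := h
      refine ⟨_, hF₁ hV, hc₁ V, fun y₁ hy₁ hU₁ => ?_⟩
      have h := (Metric.edist_le_ediam_of_mem hU₀ hU₁).trans (hU n)
      rw [edist_dist, ENNReal.ofReal_le_ofReal_iff (hε n).le] at h
      exact absurd (hsep V y₀ hy₀ y₁ hy₁) (not_lt.2 (h.trans (hεδ n V hV)))
  refine ⟨i + 1, fun p q hp hpq => ?_⟩
  have start : ∃ V ∈ F p, V.1 ⊆ B := by
    induction p, hp using Nat.le_induction with
    | base => exact ⟨e' i, by rw [hF]; exact Finset.mem_insert_self _ _, hiB⟩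
    | succ n _ ih =>
      obtain ⟨V, hV, hVB⟩ := ih (by omega)
      exact ⟨c₀ V, hF₀ hV, (hc₀ V).trans hVB⟩
  have main : ∃ V ∈ F q, V.1 ⊆ B ∧ ∀ n, p ≤ n → n < q → ∀ y ∈ V.1, f y ∉ U n := by
    induction q, hpq using Nat.le_induction with
    | base =>
      obtain ⟨V, hV, hVB⟩ := start
      exact ⟨V, hV, hVB, fun n h₁ h₂ => by omega⟩
    | succ q _ ih =>
      obtain ⟨V, hV, hVB, h⟩ := ih
      obtain ⟨W, hW, hWV, hWU⟩ := avoid hV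
      refine ⟨W, hW, hWV.trans hVB, fun n hpn hnq y hy => ?_⟩
      rcases (Nat.lt_succ_iff_lt_or_eq.1 hnq) with hn | rfl
      · exact h n hpn hn y (hWV hy)
      · exact hWU y hy
  obtain ⟨V, -, hVB, h⟩ := main
  exact ⟨V.1, V.2.1, V.2.2, hVB, h⟩

/-- Every sharp measure zero set is universally meager: if `X`, `Y` are nonempty perfect
Polish spaces, `E ⊆ X` has sharp measure zero (for a complete metric inducing the topology
of `X`), and `f : Y → X` is continuous and injective, then `f ⁻¹' E` is meager in `Y`. -/
theorem stmt18 (X : Type) [MetricSpace X] [CompleteSpace X]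
    [TopologicalSpace.SeparableSpace X] [Nonempty X] (hXperf : Perfect (Set.univ : Set X))
    (Y : Type) [TopologicalSpace Y] [PolishSpace Y] [Nonempty Y]
    (hYperf : Perfect (Set.univ : Set Y))
    (E : Set X) (hE : IsSSMZ E) (f : Y → X) (hf : Continuous f)
    (hinj : Function.Injective f) :
    IsMeagre (f ⁻¹' E) := by
  obtain ⟨ε, hε, hU⟩ := exists_pos_seq_forall_exists_open_disjoint hYperf hf hinj
  obtain ⟨U, ⟨k, -, hk, hcov⟩, hdiam⟩ := hE ε hε
  let M (m : ℕ) : Set Y := {y | ∀ j, m ≤ j → ∃ n, k j ≤ n ∧ n < k (j + 1) ∧ f y ∈ U n}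
  have hM (m : ℕ) : IsNowhereDense (M m) := by
    refine not_nonempty_iff_eq_empty.1 fun hne => ?_
    obtain ⟨N, hN⟩ := hU U hdiam _ isOpen_interior hne
    obtain ⟨V, hVo, ⟨y, hy⟩, hVM, hV⟩ := hN (k (max m N)) (k (max m N + 1))
      ((le_max_right m N).trans (hk.id_le _)) (hk.monotone (Nat.le_succ _))
    obtain ⟨z, hzV, hzM⟩ := mem_closure_iff.1 (interior_subset (hVM hy)) V hVo hy
    obtain ⟨n, h₁, h₂, h₃⟩ := hzM _ (le_max_left m N)
    exact hV n h₁ h₂ z hzV h₃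
  refine (isMeagre_iUnion fun m => (hM m).isMeagre).mono fun y hy => ?_
  obtain ⟨m, hm⟩ := eventually_atTop.1 (hcov (f y) hy)
  exact mem_iUnion.2 ⟨m, hm⟩
end
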